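/- arXiv:2001.07642 — 4 statements merged into one kernel-verified Lean document; each statement's English description precedes it below -/
import Mathlib

section
/- Let Q be a polytope with face lattice P (all faces of Q ordered by inclusion together with a bottom element 0̂, where the rank of a nonempty face x is dim(x)+1 and rk(0̂)=0). Then for every element x of P, the Möbius number satisfies μ_P(0̂, x) = (−1)^{rk(x)}. -/
open scoped Classical

open Filter Topology

/-- The jumps `g t - g (t+)` of `g` sum to `c`: over every sufficiently large finite set of
points, the sum of the differences `g t - g (t + ε)` is `c` for all small `ε > 0`. -/
def HasJumpSum (g : ℝ → ℝ) (c : ℝ) : Prop :=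
  ∃ E : Finset ℝ, ∀ T : Finset ℝ, E ⊆ T →
    ∀ᶠ ε in 𝓝[>] (0 : ℝ), ∑ t ∈ T, (g t - g (t + ε)) = c

namespace HasJumpSum

theorem unique {g : ℝ → ℝ} {c d : ℝ} (hc : HasJumpSum g c) (hd : HasJumpSum g d) : c = d := by
  obtain ⟨E, hE⟩ := hc
  obtain ⟨E', hE'⟩ := hd
  obtain ⟨ε, h, h'⟩ :=
    ((hE _ Finset.subset_union_left).and (hE' _ Finset.subset_union_right)).exists
  exact h.symm.trans h'

theorem zero : HasJumpSum (fun _ ↦ 0) 0 := ⟨∅, fun T _ ↦ by simp⟩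

theorem add {g h : ℝ → ℝ} {c d : ℝ} (hc : HasJumpSum g c) (hd : HasJumpSum h d) :
    HasJumpSum (fun t ↦ g t + h t) (c + d) := by
  obtain ⟨E, hE⟩ := hc
  obtain ⟨E', hE'⟩ := hd
  refine ⟨E ∪ E', fun T hT ↦ ?_⟩
  filter_upwards [hE T (Finset.union_subset_left hT), hE' T (Finset.union_subset_right hT)]
    with ε h₁ h₂
  rw [← h₁, ← h₂, ← Finset.sum_add_distrib]
  exact Finset.sum_congr rfl fun t _ ↦ by ring

theorem sum {ι : Type*} {I : Finset ι} {g : ι → ℝ → ℝ} {c : ι → ℝ}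
    (h : ∀ i ∈ I, HasJumpSum (g i) (c i)) :
    HasJumpSum (fun t ↦ ∑ i ∈ I, g i t) (∑ i ∈ I, c i) := by
  induction I using Finset.induction_on with
  | empty => simpa using zero
  | insert i I hi ih =>
    simp only [Finset.sum_insert hi]
    exact (h i (by simp)).add (ih fun j hj ↦ h j (by simp [hj]))

theorem of_single_jump {g : ℝ → ℝ} {a c : ℝ}
    (h : ∀ t, ∀ᶠ ε in 𝓝[>] (0 : ℝ), g t - g (t + ε) = if t = a then c else 0) :
    HasJumpSum g c := by
  refine ⟨{a}, fun T hT ↦ ?_⟩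
  filter_upwards [(Filter.eventually_all_finset T).2 fun t _ ↦ h t] with ε hε
  rw [Finset.sum_congr rfl hε, Finset.sum_ite_eq']
  simp [Finset.singleton_subset_iff.1 hT]

theorem eventually_add_lt {t a : ℝ} (h : t < a) : ∀ᶠ ε in 𝓝[>] (0 : ℝ), t + ε < a := by
  filter_upwards [Ioo_mem_nhdsGT (sub_pos.2 h)] with ε hε
  linarith [hε.2]

theorem indicator_Icc {a b : ℝ} (hab : a ≤ b) (c : ℝ) :
    HasJumpSum (fun t ↦ if t ∈ Set.Icc a b then c else 0) c := by
  refine of_single_jump (a := b) fun t ↦ ?_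
  have hpos : ∀ᶠ ε in 𝓝[>] (0 : ℝ), 0 < ε := self_mem_nhdsWithin
  rcases lt_or_ge t a with h | h
  · filter_upwards [eventually_add_lt h] with ε hε
    simp [h.not_ge, hε.not_ge, (h.trans_le hab).ne]
  rcases lt_or_ge t b with h' | h'
  · filter_upwards [eventually_add_lt h', hpos] with ε hε hp
    simp [h, h'.le, hε.le, h'.ne, h.trans (by linarith : t ≤ t + ε)]
  · filter_upwards [hpos] with ε hp
    have h₁ : ¬ t + ε ≤ b := by linarith
    rcases h'.eq_or_lt with rfl | h''
    · simp [hab, hp]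
    · simp [h''.not_ge, h₁, h''.ne']

theorem indicator_Ioo {a b : ℝ} (hab : a < b) (c : ℝ) :
    HasJumpSum (fun t ↦ if t ∈ Set.Ioo a b then c else 0) (-c) := by
  refine of_single_jump (a := a) fun t ↦ ?_
  have hpos : ∀ᶠ ε in 𝓝[>] (0 : ℝ), 0 < ε := self_mem_nhdsWithin
  rcases lt_or_ge t a with h | h
  · filter_upwards [eventually_add_lt h] with ε hε
    simp [h.le.not_gt, hε.le.not_gt, h.ne]
  rcases lt_or_ge t b with h' | h'
  · filter_upwards [eventually_add_lt h', hpos] with ε hε hp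
    have h₁ : a < t + ε := by linarith
    rcases h.eq_or_lt with rfl | h''
    · simp [hε, hp]
    · simp [h'', h', hε, h₁, h''.ne']
  · filter_upwards [hpos] with ε hp
    have h₁ : ¬ t + ε < b := by linarith
    simp [h'.not_gt, h₁, (hab.trans_le h').ne']

end HasJumpSum

section RelativeInterior

variable {V : Type*} [AddCommGroup V] [Module ℝ V]

/-- The algebraic relative interior of a set: the points through which every segment issuing from
a point of the set can be prolonged inside the set. -/
def algRelint (C : Set V) : Set V :=
  {x ∈ C | ∀ y ∈ C, ∃ ε > (0 : ℝ), x + ε • (x - y) ∈ C}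

variable {C : Set V}

theorem algRelint_subset (C : Set V) : algRelint C ⊆ C := fun _ hx ↦ hx.1

theorem Convex.exists_add_smul_mem_of_mem_algRelint (hC : Convex ℝ C) {x v : V}
    (hx : x ∈ algRelint C) (hv : v ∈ vectorSpan ℝ C) : ∃ ε > (0 : ℝ), x + ε • v ∈ C := by
  have hadd {v w : V} : (∃ ε > (0 : ℝ), x + ε • v ∈ C) → (∃ ε > (0 : ℝ), x + ε • w ∈ C) →
      ∃ ε > (0 : ℝ), x + ε • (v + w) ∈ C := by
    rintro ⟨ε, hε, h⟩ ⟨δ, hδ, h'⟩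
    refine ⟨ε * δ / (ε + δ), by positivity, ?_⟩
    convert hC h h' (a := δ / (ε + δ)) (b := ε / (ε + δ)) (by positivity) (by positivity)
      (by field_simp; ring) using 1
    match_scalars <;> field_simp
    ring
  have hsmul {v : V} {r : ℝ} (hr : 0 < r) : (∃ ε > (0 : ℝ), x + ε • v ∈ C) →
      ∃ ε > (0 : ℝ), x + ε • (r • v) ∈ C := by
    rintro ⟨ε, hε, h⟩
    refine ⟨ε / r, by positivity, ?_⟩
    rwa [smul_smul, div_mul_cancel₀ _ hr.ne']
  suffices h : (∃ ε > (0 : ℝ), x + ε • v ∈ C) ∧ ∃ ε > (0 : ℝ), x + ε • (-v) ∈ C from h.1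
  rw [vectorSpan_eq_span_vsub_set_right ℝ hx.1] at hv
  induction hv using Submodule.span_induction with
  | mem v hv =>
    obtain ⟨y, hy, rfl⟩ := hv
    refine ⟨⟨1, one_pos, by simpa using hy⟩, ?_⟩
    simpa using hx.2 y hy
  | zero => simpa using ⟨⟨1, one_pos⟩, hx.1⟩
  | add v w _ _ hv hw =>
    refine ⟨hadd hv.1 hw.1, ?_⟩
    rw [neg_add]
    exact hadd hv.2 hw.2
  | smul r v _ hv =>
    rcases lt_trichotomy r 0 with hr | rfl | hr
    · have := hsmul (neg_pos.2 hr) hv.1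
      have h' := hsmul (neg_pos.2 hr) hv.2
      simp only [neg_smul, smul_neg, neg_neg] at this h' ⊢
      exact ⟨h', this⟩
    · simpa using ⟨⟨1, one_pos⟩, hx.1⟩
    · refine ⟨hsmul hr hv.1, ?_⟩
      simpa only [smul_neg] using hsmul hr hv.2

theorem Convex.combo_mem_algRelint (hC : Convex ℝ C) {x y : V} (hx : x ∈ algRelint C)
    (hy : y ∈ C) {a b : ℝ} (ha : 0 < a) (hb : 0 ≤ b) (hab : a + b = 1) :
    a • x + b • y ∈ algRelint C := by
  obtain rfl : a = 1 - b := by linarith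
  refine ⟨hC hx.1 hy ha.le hb hab, fun w hw ↦ ?_⟩
  obtain ⟨ε, hε, h⟩ := hx.2 w hw
  have hd : 0 < 1 + ε * b := by positivity
  refine ⟨ε * (1 - b) / (1 + ε * b), by positivity, ?_⟩
  convert hC h hy (a := (1 - b) / (1 + ε * b)) (b := (1 + ε * (1 - b) / (1 + ε * b)) * b)
    (by positivity) (by positivity) ?_ using 1
  · match_scalars <;> field_simp
    ring
  · field_simp
    ring

theorem Convex.convex_algRelint (hC : Convex ℝ C) : Convex ℝ (algRelint C) := by
  intro x hx y hy a b ha hb hab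
  rcases ha.eq_or_lt with rfl | ha
  · obtain rfl : b = 1 := by linarith
    simpa using hy
  · exact hC.combo_mem_algRelint hx hy.1 ha hb hab

theorem Convex.algRelint_subset_algRelint_algRelint (hC : Convex ℝ C) :
    algRelint C ⊆ algRelint (algRelint C) := by
  refine fun x hx ↦ ⟨hx, fun y hy ↦ ?_⟩
  obtain ⟨ε, hε, h⟩ := hx.2 y hy.1
  refine ⟨ε / 2, by positivity, ?_⟩
  convert hC.combo_mem_algRelint hx h (a := 1 / 2) (b := 1 / 2) (by norm_num) (by norm_num)
    (by norm_num) using 1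
  module

theorem Convex.vectorSpan_algRelint (hC : Convex ℝ C) (hne : (algRelint C).Nonempty) :
    vectorSpan ℝ (algRelint C) = vectorSpan ℝ C := by
  refine le_antisymm (vectorSpan_mono ℝ (algRelint_subset C)) ?_
  obtain ⟨x, hx⟩ := hne
  rw [vectorSpan_eq_span_vsub_set_right ℝ hx.1, Submodule.span_le]
  rintro _ ⟨y, hy, rfl⟩
  have h := vsub_mem_vectorSpan ℝ (hC.combo_mem_algRelint hx hy (a := 1 / 2) (b := 1 / 2)
    (by norm_num) (by norm_num) (by norm_num)) hx
  have h2 := Submodule.smul_mem _ (2 : ℝ) h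
  rwa [vsub_eq_sub, show (2 : ℝ) • ((1 / 2 : ℝ) • x + (1 / 2 : ℝ) • y - x) = y - x by module]
    at h2

theorem Convex.vectorSpan_inter_level (hC : Convex ℝ C) (l : V →ₗ[ℝ] ℝ) {x : V}
    (hx : x ∈ algRelint C) :
    vectorSpan ℝ (C ∩ {y | l y = l x}) = vectorSpan ℝ C ⊓ LinearMap.ker l := by
  have hxl : x ∈ C ∩ {y | l y = l x} := ⟨hx.1, rfl⟩
  refine le_antisymm (le_inf (vectorSpan_mono ℝ Set.inter_subset_left) ?_) ?_
  · rw [vectorSpan_eq_span_vsub_set_right ℝ hxl, Submodule.span_le]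
    rintro _ ⟨y, hy, rfl⟩
    simpa [sub_eq_zero] using hy.2
  · rintro v ⟨hv, hl⟩
    obtain ⟨ε, hε, h⟩ := hC.exists_add_smul_mem_of_mem_algRelint hx hv
    have hl' : l v = 0 := hl
    have hxv : x + ε • v ∈ C ∩ {y | l y = l x} := ⟨h, by simp [hl']⟩
    have h' := vsub_mem_vectorSpan ℝ hxv hxl
    have := Submodule.smul_mem _ ε⁻¹ h'
    simpa [smul_smul, hε.ne'] using this

theorem Submodule.finrank_inf_ker_add_one [FiniteDimensional ℝ V] (W : Submodule ℝ V)
    (l : V →ₗ[ℝ] ℝ) (h : ∃ v ∈ W, l v ≠ 0) :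
    Module.finrank ℝ (W ⊓ LinearMap.ker l : Submodule ℝ V) + 1 = Module.finrank ℝ W := by
  obtain ⟨v, hv, hl⟩ := h
  have hne : l.domRestrict W ≠ 0 := fun h0 ↦ hl (by simpa using LinearMap.congr_fun h0 ⟨v, hv⟩)
  rw [← Module.Dual.finrank_ker_add_one_of_ne_zero hne, LinearMap.ker_domRestrict,
    ← Submodule.map_comap_subtype, Submodule.finrank_map_subtype_eq]

end RelativeInterior

section EulerCharacteristic

variable {V : Type*} [NormedAddCommGroup V] [NormedSpace ℝ V]

/-- The Euler characteristic of a bounded relatively open convex set: `0` for the empty set, and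
`(-1) ^ dim C` otherwise. -/
noncomputable def openEulerChar (C : Set V) : ℝ :=
  if C = ∅ then 0 else (-1) ^ Module.finrank ℝ (vectorSpan ℝ C)

theorem openEulerChar_empty : openEulerChar (∅ : Set V) = 0 := if_pos rfl

theorem openEulerChar_singleton (x : V) : openEulerChar ({x} : Set V) = 1 := by
  rw [openEulerChar, if_neg (Set.singleton_ne_empty x), vectorSpan_singleton, finrank_bot, pow_zero]

theorem Convex.image_eq_Ioo {C : Set V} (hC : Convex ℝ C) (ho : C ⊆ algRelint C)
    (l : V →ₗ[ℝ] ℝ) (hb : Bornology.IsBounded (l '' C)) (hne : C.Nonempty)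
    (hl : ∃ v ∈ vectorSpan ℝ C, l v ≠ 0) : ∃ a b, a < b ∧ l '' C = Set.Ioo a b := by
  have hne' : (l '' C).Nonempty := hne.image l
  have key : ∀ x ∈ C, ∃ y ∈ C, l x < l y := by
    intro x hx
    obtain ⟨v, hv, hlv⟩ := hl
    wlog hpos : 0 < l v generalizing v
    · exact this (-v) (neg_mem hv) (by simpa using hlv)
        (by simpa using lt_of_le_of_ne (not_lt.1 hpos) hlv)
    obtain ⟨ε, hε, h⟩ := hC.exists_add_smul_mem_of_mem_algRelint (ho hx) hv
    exact ⟨_, h, by simpa using mul_pos hε hpos⟩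
  have key' : ∀ x ∈ C, ∃ y ∈ C, l y < l x := by
    intro x hx
    obtain ⟨y, hy, hxy⟩ := key x hx
    obtain ⟨ε, hε, h⟩ := (ho hx).2 y hy
    refine ⟨_, h, ?_⟩
    simpa using mul_neg_of_pos_of_neg hε (sub_neg.2 hxy)
  have hsub : l '' C ⊆ Set.Ioo (sInf (l '' C)) (sSup (l '' C)) := by
    rintro _ ⟨x, hx, rfl⟩
    obtain ⟨y, hy, hxy⟩ := key x hx
    obtain ⟨z, hz, hzx⟩ := key' x hx
    exact ⟨(csInf_le hb.bddBelow ⟨z, hz, rfl⟩).trans_lt hzx,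
      hxy.trans_le (le_csSup hb.bddAbove ⟨y, hy, rfl⟩)⟩
  have ⟨t, ht⟩ := hne'
  refine ⟨_, _, (hsub ht).1.trans (hsub ht).2, hsub.antisymm ?_⟩
  exact IsConnected.Ioo_csInf_csSup_subset ⟨hne', (hC.linear_image l).isPreconnected⟩
    hb.bddBelow hb.bddAbove

theorem Convex.hasJumpSum_openEulerChar [FiniteDimensional ℝ V] {C : Set V} (hC : Convex ℝ C)
    (ho : C ⊆ algRelint C) (l : V →ₗ[ℝ] ℝ) (hb : Bornology.IsBounded (l '' C)) :
    HasJumpSum (fun t ↦ openEulerChar (C ∩ {x | l x = t})) (openEulerChar C) := by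
  rcases C.eq_empty_or_nonempty with rfl | hne
  · simpa [openEulerChar_empty] using HasJumpSum.zero
  by_cases hl : ∃ v ∈ vectorSpan ℝ C, l v ≠ 0
  · obtain ⟨a, b, hab, h⟩ := hC.image_eq_Ioo ho l hb hne hl
    convert HasJumpSum.indicator_Ioo hab (-openEulerChar C) using 1
    · ext t
      split_ifs with ht
      · rw [← h] at ht
        obtain ⟨x, hx, rfl⟩ := ht
        rw [openEulerChar, openEulerChar, if_neg hne.ne_empty,
          if_neg (Set.Nonempty.ne_empty (s := C ∩ {y | l y = l x}) ⟨x, hx, rfl⟩), hC.vectorSpan_inter_level l (ho hx),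
          ← Submodule.finrank_inf_ker_add_one _ l hl, pow_succ]
        ring
      · convert openEulerChar_empty (V := V)
        refine Set.eq_empty_of_forall_notMem fun x hx ↦ ht ?_
        rw [← h]
        exact ⟨x, hx⟩
    · rw [neg_neg]
  · push Not at hl
    obtain ⟨x, hx⟩ := hne
    have hconst : ∀ y ∈ C, l y = l x := fun y hy ↦ by
      simpa [sub_eq_zero] using hl _ (vsub_mem_vectorSpan ℝ hy hx)
    convert HasJumpSum.indicator_Icc (le_refl (l x)) (openEulerChar C) using 2 with t
    simp only [Set.Icc_self, Set.mem_singleton_iff]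
    split_ifs with ht
    · congr 1
      exact Set.inter_eq_left.2 fun y hy ↦ (hconst y hy).trans ht.symm
    · convert openEulerChar_empty (V := V)
      exact Set.eq_empty_of_forall_notMem fun y hy ↦ ht (hy.2.symm.trans (hconst y hy.1))

theorem Convex.hasJumpSum_nonempty [FiniteDimensional ℝ V] {K : Set V} (hK : Convex ℝ K)
    (hc : IsCompact K) (l : V →ₗ[ℝ] ℝ) :
    HasJumpSum (fun t ↦ if (K ∩ {x | l x = t}).Nonempty then 1 else 0)
      (if K.Nonempty then 1 else 0) := by
  rcases K.eq_empty_or_nonempty with rfl | hne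
  · simpa using HasJumpSum.zero
  have h := eq_Icc_of_connected_compact
    ⟨hne.image l, (hK.linear_image l).isPreconnected⟩
    (hc.image l.continuous_of_finiteDimensional)
  have hle : sInf (l '' K) ≤ sSup (l '' K) :=
    Set.nonempty_Icc.1 (h ▸ hne.image l)
  rw [if_pos hne]
  convert HasJumpSum.indicator_Icc hle 1 using 4 with t
  rw [← h]
  rfl

/-- Additivity of the Euler characteristic: if a compact convex set is partitioned into finitely
many relatively open convex sets, then their Euler characteristics sum to one. -/
theorem Convex.sum_openEulerChar_eq [FiniteDimensional ℝ V] {ι : Type*} {I : Finset ι} (n : ℕ)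
    {W : Submodule ℝ V} (hW : Module.finrank ℝ W = n) {K : Set V} {C : ι → Set V}
    (hK : Convex ℝ K) (hc : IsCompact K) (hKW : ∀ x ∈ K, ∀ y ∈ K, x - y ∈ W)
    (hC : ∀ i ∈ I, Convex ℝ (C i)) (ho : ∀ i ∈ I, C i ⊆ algRelint (C i))
    (hsub : ∀ i ∈ I, C i ⊆ K)
    (hpart : ∀ x ∈ K, ∑ i ∈ I, (if x ∈ C i then (1 : ℝ) else 0) = 1) :
    ∑ i ∈ I, openEulerChar (C i) = if K.Nonempty then 1 else 0 := by
  induction n using Nat.strong_induction_on generalizing W K C with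
  | _ n ih =>
  by_cases hbot : W = ⊥
  · rcases K.eq_empty_or_nonempty with rfl | ⟨x, hx⟩
    · rw [if_neg Set.not_nonempty_empty]
      refine Finset.sum_eq_zero fun i hi ↦ ?_
      rw [Set.subset_empty_iff.1 (hsub i hi), openEulerChar_empty]
    · rw [if_pos ⟨x, hx⟩, ← hpart x hx]
      have hKx : ∀ y ∈ K, y = x := fun y hy ↦ by
        simpa [hbot, sub_eq_zero] using hKW y hy x hx
      refine Finset.sum_congr rfl fun i hi ↦ ?_
      split_ifs with hxi
      · rw [← openEulerChar_singleton x]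
        congr 1
        exact Set.Subset.antisymm (fun y hy ↦ hKx y (hsub i hi hy)) (by simpa using hxi)
      · convert openEulerChar_empty (V := V)
        exact Set.eq_empty_of_forall_notMem fun y hy ↦ hxi (hKx y (hsub i hi hy) ▸ hy)
  · obtain ⟨w, hw, hw0⟩ := Submodule.exists_mem_ne_zero_of_ne_bot hbot
    obtain ⟨f, hf⟩ := SeparatingDual.exists_ne_zero (R := ℝ) hw0
    let l : V →ₗ[ℝ] ℝ := f
    have hlt : Module.finrank ℝ (W ⊓ LinearMap.ker l : Submodule ℝ V) < n := by
      rw [← hW, ← Submodule.finrank_inf_ker_add_one W l ⟨w, hw, hf⟩]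
      exact Nat.lt_succ_self _
    have hsum : HasJumpSum (fun t ↦ ∑ i ∈ I, openEulerChar (C i ∩ {x | l x = t}))
        (∑ i ∈ I, openEulerChar (C i)) :=
      HasJumpSum.sum fun i hi ↦ (hC i hi).hasJumpSum_openEulerChar (ho i hi) l
        (((hc.image f.continuous).isBounded).subset (Set.image_mono (hsub i hi)))
    refine hsum.unique ?_
    convert hK.hasJumpSum_nonempty hc l using 2 with t
    have hconv : Convex ℝ {x | l x = t} := convex_hyperplane l.isLinear t
    refine ih _ hlt rfl (hK.inter hconv)
      (hc.inter_right (isClosed_eq f.continuous continuous_const)) ?_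
      (fun i hi ↦ (hC i hi).inter hconv) ?_
      (fun i hi ↦ Set.inter_subset_inter_left _ (hsub i hi)) ?_
    · rintro x ⟨hx, hxt⟩ y ⟨hy, hyt⟩
      refine ⟨hKW x hx y hy, ?_⟩
      simp only [Set.mem_ofPred_eq] at hxt hyt
      simp [hxt, hyt]
    · rintro i hi x ⟨hx, hxt⟩
      refine ⟨⟨hx, hxt⟩, fun y hy ↦ ?_⟩
      obtain ⟨ε, hε, h⟩ := (ho i hi hx).2 y hy.1
      refine ⟨ε, hε, h, ?_⟩
      have hyt := hy.2
      simp only [Set.mem_ofPred_eq] at hxt hyt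
      simp [hxt, hyt]
    · rintro x ⟨hx, hxt⟩
      simpa only [Set.mem_inter_iff, hxt, and_true] using hpart x hx

end EulerCharacteristic

section Faces

variable {V : Type*} [NormedAddCommGroup V] [NormedSpace ℝ V]

theorem intrinsicInterior_subset_algRelint (C : Set V) : intrinsicInterior ℝ C ⊆ algRelint C := by
  intro x hx
  refine ⟨intrinsicInterior_subset hx, fun y hy ↦ ?_⟩
  obtain ⟨p, hp, rfl⟩ := mem_intrinsicInterior.1 hx
  have : Nonempty (affineSpan ℝ C) := ⟨p⟩
  let q : affineSpan ℝ C := ⟨y, subset_affineSpan ℝ C hy⟩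
  have hcoe : ∀ t : ℝ, ((AffineMap.lineMap p q (-t) : affineSpan ℝ C) : V) = p + t • (p - y) := by
    intro t
    change (-t) • (y - (p : V)) + p = _
    module
  have hcont : Continuous fun t : ℝ ↦ (AffineMap.lineMap p q (-t) : affineSpan ℝ C) := by
    refine continuous_induced_rng.2 ?_
    simp only [Function.comp_def, hcoe]
    fun_prop
  have h0 : ∀ᶠ t in 𝓝 (0 : ℝ),
      (AffineMap.lineMap p q (-t) : affineSpan ℝ C) ∈ ((↑) ⁻¹' C : Set (affineSpan ℝ C)) := by
    refine hcont.continuousAt.eventually_mem ?_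
    simpa using mem_interior_iff_mem_nhds.1 hp
  obtain ⟨ε, hε, hpos⟩ :=
    ((h0.filter_mono nhdsWithin_le_nhds).and (self_mem_nhdsWithin (s := Set.Ioi (0 : ℝ)))).exists
  exact ⟨ε, hpos, hcoe ε ▸ hε⟩

theorem Convex.algRelint_nonempty [FiniteDimensional ℝ V] {C : Set V} (hC : Convex ℝ C)
    (hne : C.Nonempty) : (algRelint C).Nonempty :=
  (hne.intrinsicInterior hC).mono (intrinsicInterior_subset_algRelint C)

/-- Supporting hyperplane theorem: a point of a convex set outside of its relative interior is
a maximizer of some functional which is not constant on the set. -/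
theorem Convex.exists_supporting_of_notMem_algRelint [FiniteDimensional ℝ V] {C : Set V}
    (hC : Convex ℝ C) {x : V} (hx : x ∈ C) (hxi : x ∉ algRelint C) :
    ∃ f : StrongDual ℝ V, (∀ y ∈ C, f y ≤ f x) ∧ ∃ y ∈ C, f y < f x := by
  let p : affineSpan ℝ C := ⟨x, subset_affineSpan ℝ C hx⟩
  have : Nonempty C := ⟨x, hx⟩
  let e := AffineIsometryEquiv.vaddConst ℝ p
  let A : Set (affineSpan ℝ C).direction := e ⁻¹' ((↑) ⁻¹' C)
  have hA : Convex ℝ A :=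
    hC.affine_preimage ((affineSpan ℝ C).subtype.comp e.toAffineEquiv.toAffineMap)
  have hint : (interior A).Nonempty := by
    rw [hA.interior_nonempty_iff_affineSpan_eq_top]
    have hspan : affineSpan ℝ ((↑) ⁻¹' C : Set (affineSpan ℝ C)) = ⊤ :=
      affineSpan_coe_preimage_eq_top C
    have := AffineSubspace.comap_span e.toAffineEquiv ((↑) ⁻¹' C : Set (affineSpan ℝ C))
    rw [hspan, AffineSubspace.comap_top] at this
    exact this.symm
  have h0 : (0 : (affineSpan ℝ C).direction) ∉ interior A := by
    intro h
    have h' : e 0 ∈ interior ((↑) ⁻¹' C : Set (affineSpan ℝ C)) := by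
      have := e.toHomeomorph.preimage_interior ((↑) ⁻¹' C : Set (affineSpan ℝ C))
      exact (Set.ext_iff.1 this 0).2 h
    refine hxi (intrinsicInterior_subset_algRelint C (mem_intrinsicInterior.2 ⟨_, h', ?_⟩))
    simp [e, p]
  obtain ⟨f, hf, hmax⟩ := geometric_hahn_banach_of_nonempty_interior_point hA h0 hint
  obtain ⟨g, hg, -⟩ := exists_extension_norm_eq _ f
  have hdir : ∀ y ∈ C, y - x ∈ (affineSpan ℝ C).direction := fun y hy ↦
    AffineSubspace.vsub_mem_direction (subset_affineSpan ℝ C hy) p.2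
  have hle : ∀ y ∈ C, g y ≤ g x := by
    intro y hy
    have := hmax ⟨y - x, hdir y hy⟩ (by simpa [A, e, p] using hy)
    rw [← hg, map_zero] at this
    simpa using this
  refine ⟨g, hle, ?_⟩
  by_contra! hge
  refine hf (ContinuousLinearMap.ext fun v ↦ ?_)
  have hker : vectorSpan ℝ C ≤ LinearMap.ker (g : V →ₗ[ℝ] ℝ) := by
    rw [vectorSpan_eq_span_vsub_set_right ℝ hx, Submodule.span_le]
    rintro _ ⟨y, hy, rfl⟩
    simpa [sub_eq_zero] using (hle y hy).antisymm (hge y hy)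
  rw [← hg]
  exact hker (by simpa only [direction_affineSpan] using v.2)

theorem isExposed_of_forall_vertices {s : Set V} {G : Set V} {h : StrongDual ℝ V} {g : V}
    (hGQ : G ⊆ convexHull ℝ s) (hG : Convex ℝ G) (hg : g ∈ G) (hconst : ∀ x ∈ G, h x = h g)
    (hs : ∀ v ∈ s, v ∈ G ∨ h v < h g) : IsExposed ℝ (convexHull ℝ s) G := by
  refine fun _ ↦ ⟨h, ?_⟩
  have hconv : Convex ℝ (G ∪ {x | h x < h g}) := by
    have hle : ∀ x ∈ G ∪ {x | h x < h g}, h x ≤ h g := by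
      rintro x (hx | hx)
      exacts [(hconst x hx).le, le_of_lt hx]
    refine convex_iff_forall_pos.2 fun x hx y hy a b ha hb hab ↦ ?_
    by_cases hxy : x ∈ G ∧ y ∈ G
    · exact Or.inl (hG hxy.1 hxy.2 ha.le hb.le hab)
    right
    have hg' : h g = a * h g + b * h g := by rw [← add_mul, hab, one_mul]
    simp only [Set.mem_ofPred_eq, map_add, map_smul, smul_eq_mul]
    rw [hg']
    by_cases hxG : x ∈ G
    · have hy' : h y < h g := hy.resolve_left fun hyG ↦ hxy ⟨hxG, hyG⟩
      exact add_lt_add_of_le_of_lt (mul_le_mul_of_nonneg_left (hle x hx) ha.le)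
        (mul_lt_mul_of_pos_left hy' hb)
    · have hx' : h x < h g := hx.resolve_left hxG
      exact add_lt_add_of_lt_of_le (mul_lt_mul_of_pos_left hx' ha)
        (mul_le_mul_of_nonneg_left (hle y hy) hb.le)
  have hmem : ∀ x ∈ convexHull ℝ s, x ∈ G ∨ h x < h g := fun x hx ↦ convexHull_min hs hconv hx
  refine Set.Subset.antisymm (fun x hx ↦ ⟨hGQ hx, fun y hy ↦ ?_⟩) fun x hx ↦ ?_
  · rw [hconst x hx]
    exact (hmem y hy).elim (fun hyG ↦ (hconst y hyG).le) le_of_lt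
  · exact (hmem x hx.1).resolve_right (hx.2 g (hGQ hg)).not_gt

/-- A face of a face of a polytope is a face of the polytope. -/
theorem IsExposed.trans_of_convexHull {s : Finset V} {F G : Set V}
    (hF : IsExposed ℝ (convexHull ℝ (s : Set V)) F) (hG : IsExposed ℝ F G) :
    IsExposed ℝ (convexHull ℝ (s : Set V)) G := by
  rcases G.eq_empty_or_nonempty with rfl | ⟨g, hg⟩
  · exact isExposed_empty
  have hFc := hF.convex (convex_convexHull ℝ _)
  have hGc := hG.convex hFc
  have hGF := hG.subset
  have hFQ := hF.subset
  obtain ⟨l, hl⟩ := hF ⟨g, hGF hg⟩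
  obtain ⟨m, hm⟩ := hG ⟨g, hg⟩
  have hlF : ∀ x ∈ F, l x = l g := fun x hx ↦ by
    have hx' := hx
    have hg' := hGF hg
    rw [hl] at hx' hg'
    exact (hg'.2 x hx'.1).antisymm (hx'.2 g hg'.1)
  have hmG : ∀ x ∈ G, m x = m g := fun x hx ↦ by
    have hx' := hx
    have hg' := hg
    rw [hm] at hx' hg'
    exact (hg'.2 x hx'.1).antisymm (hx'.2 g hg'.1)
  have hlQ : ∀ x ∈ convexHull ℝ (s : Set V), x ∈ F ∨ l x < l g := fun x hx ↦ by
    by_contra! h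
    have hg' := hGF hg
    rw [hl] at h hg'
    exact h.1 ⟨hx, fun y hy ↦ (hg'.2 y hy).trans h.2⟩
  have hmF : ∀ x ∈ F, x ∈ G ∨ m x < m g := fun x hx ↦ by
    by_contra! h
    have hg' := hg
    rw [hm] at h hg'
    exact h.1 ⟨hx, fun y hy ↦ (hg'.2 y hy).trans h.2⟩
  have hev : ∀ᶠ ε in 𝓝[>] (0 : ℝ), ∀ v ∈ s, v ∈ G ∨ (l + ε • m) v < (l + ε • m) g := by
    refine (Filter.eventually_all_finset s).2 fun v hv ↦ ?_
    rcases hlQ v (subset_convexHull ℝ _ hv) with hvF | hvF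
    · rcases hmF v hvF with hvG | hvG
      · exact Eventually.of_forall fun _ ↦ Or.inl hvG
      · filter_upwards [self_mem_nhdsWithin] with ε hε
        right
        simpa [hlF v hvF] using mul_lt_mul_of_pos_left hvG hε
    · refine nhdsWithin_le_nhds ?_
      have h1 : ContinuousAt (fun ε : ℝ ↦ (l + ε • m) v) 0 := by
        simp only [add_apply, smul_apply]
        fun_prop
      have h2 : ContinuousAt (fun ε : ℝ ↦ (l + ε • m) g) 0 := by
        simp only [add_apply, smul_apply]
        fun_prop
      exact (h1.eventually_lt h2 (by simpa using hvF)).mono fun _ ↦ Or.inr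
  obtain ⟨ε, hε⟩ := hev.exists
  refine isExposed_of_forall_vertices (hGF.trans hFQ) hGc hg (fun x hx ↦ ?_) hε
  simp [hlF x (hGF hx), hmG x hx]

theorem finite_isExposed_convexHull [FiniteDimensional ℝ V] (s : Finset V) :
    {G | IsExposed ℝ (convexHull ℝ (s : Set V)) G}.Finite := by
  refine Set.Finite.of_finite_image (f := fun G ↦ G.extremePoints ℝ) ?_ ?_
  · refine s.finite_toSet.finite_subsets.subset ?_
    rintro _ ⟨G, hG, rfl⟩
    exact hG.isExtreme.extremePoints_subset_extremePoints.trans extremePoints_convexHull_subset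
  · intro G hG G' hG' h
    have hc := s.finite_toSet.isCompact_convexHull ℝ
    rw [← closure_convexHull_extremePoints (IsExposed.isCompact hG hc)
      (IsExposed.convex hG (convex_convexHull ℝ _)),
      ← closure_convexHull_extremePoints (IsExposed.isCompact hG' hc)
      (IsExposed.convex hG' (convex_convexHull ℝ _))]
    exact congrArg (fun E ↦ closure (convexHull ℝ E)) h

theorem IsExposed.subset_of_mem_algRelint {Q G F : Set V} (hF : IsExposed ℝ Q F) (hG : G ⊆ Q)
    {x : V} (hx : x ∈ algRelint G) (hxF : x ∈ F) : G ⊆ F := by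
  intro y hy
  obtain ⟨l, rfl⟩ := hF ⟨x, hxF⟩
  obtain ⟨ε, hε, h⟩ := hx.2 y hy
  have hle : l x ≤ l y := by
    have := hxF.2 _ (hG h)
    simp only [map_add, map_smul, map_sub, smul_eq_mul, add_le_iff_nonpos_right] at this
    exact sub_nonpos.1 (nonpos_of_mul_nonpos_right this hε)
  exact ⟨hG hy, fun z hz ↦ (hxF.2 z hz).trans hle⟩

theorem exists_isExposed_mem_algRelint [FiniteDimensional ℝ V] {s : Finset V} {x : V}
    (hx : x ∈ convexHull ℝ (s : Set V)) :
    ∃ G, IsExposed ℝ (convexHull ℝ (s : Set V)) G ∧ x ∈ algRelint G := by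
  obtain ⟨G, hG⟩ := ((finite_isExposed_convexHull s).inter_of_left {G | x ∈ G}).exists_minimal
    ⟨convexHull ℝ (s : Set V), IsExposed.refl (convexHull ℝ (s : Set V)), hx⟩
  obtain ⟨hGe, hxG⟩ := hG.prop
  refine ⟨G, hGe, ?_⟩
  by_contra hxi
  obtain ⟨f, hf, y, hy, hlt⟩ :=
    (IsExposed.convex hGe (convex_convexHull ℝ _)).exists_supporting_of_notMem_algRelint hxG hxi
  have hsub : G ⊆ f.toExposed G := hG.le_of_le
    ⟨IsExposed.trans_of_convexHull hGe ContinuousLinearMap.toExposed.isExposed, hxG, hf⟩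
    fun z hz ↦ hz.1
  exact ((hsub hy).2 x hxG).not_gt hlt

/-- Euler's relation for a face of a polytope. -/
theorem IsExposed.sum_openEulerChar_algRelint [FiniteDimensional ℝ V] {s : Finset V} {F : Set V}
    (hF : IsExposed ℝ (convexHull ℝ (s : Set V)) F) (hne : F.Nonempty) {I : Finset (Set V)}
    (hI : ∀ G, G ∈ I ↔ IsExposed ℝ (convexHull ℝ (s : Set V)) G ∧ G ⊆ F) :
    ∑ G ∈ I, openEulerChar (algRelint G) = 1 := by
  have hconv : ∀ G ∈ I, Convex ℝ G := fun G hG ↦ ((hI G).1 hG).1.convex (convex_convexHull ℝ _)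
  have h := Convex.sum_openEulerChar_eq (I := I) (C := algRelint) (W := ⊤) _ rfl
    (hF.convex (convex_convexHull ℝ _)) (hF.isCompact (s.finite_toSet.isCompact_convexHull ℝ))
    (fun _ _ _ _ ↦ Submodule.mem_top) (fun G hG ↦ (hconv G hG).convex_algRelint)
    (fun G hG ↦ (hconv G hG).algRelint_subset_algRelint_algRelint)
    (fun G hG ↦ (algRelint_subset G).trans ((hI G).1 hG).2) ?_
  · rw [h, if_pos hne]
  intro x hx
  obtain ⟨G, hG, hxG⟩ := exists_isExposed_mem_algRelint (hF.subset hx)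
  have hGI : G ∈ I := (hI G).2 ⟨hG, hF.subset_of_mem_algRelint hG.subset hxG hx⟩
  rw [Finset.sum_eq_single_of_mem G hGI, if_pos hxG]
  intro G' hG' hne'
  refine if_neg fun hxG' ↦ hne' ?_
  have hG'e := ((hI G').1 hG').1
  exact (hG.subset_of_mem_algRelint hG'e.subset hxG' hxG.1).antisymm
    (hG'e.subset_of_mem_algRelint hG.subset hxG hxG'.1)

end Faces

/-- let `Q` be a polytope (convex hull of a finite set) and consider its face
lattice: all (exposed) faces of `Q` ordered by inclusion, with the empty face `0̂` at the
bottom; the rank of a nonempty face is its dimension plus one, and `rk 0̂ = 0`. If `μ0`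
records the Möbius numbers `μ(0̂, ·)` of this lattice (characterized by `μ0 0̂ = 1` and
`∑_{0̂ ≤ z ≤ F} μ0 z = 0` for every nonempty face `F`), then `μ0 F = (−1)^{rk F}` for
every face `F`. -/
theorem stmt4 {V : Type*} [NormedAddCommGroup V] [NormedSpace ℝ V] [FiniteDimensional ℝ V]
    (s : Finset V) (Q : Set V) (hQ : Q = convexHull ℝ (s : Set V))
    (μ0 : Set V → ℝ)
    (hbot : μ0 ∅ = 1)
    (hrec : ∀ F : Set V, IsExposed ℝ Q F → F.Nonempty →
      (∑ᶠ G ∈ {G : Set V | IsExposed ℝ Q G ∧ G ⊆ F}, μ0 G) = 0) :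
    ∀ F : Set V, IsExposed ℝ Q F →
      μ0 F = (-1 : ℝ) ^
        (if F = ∅ then 0 else Module.finrank ℝ (vectorSpan ℝ F) + 1) := by
  subst hQ
  have hsign : ∀ G, IsExposed ℝ (convexHull ℝ (s : Set V)) G →
      (-1 : ℝ) ^ (if G = ∅ then 0 else Module.finrank ℝ (vectorSpan ℝ G) + 1) =
        (if G = ∅ then 1 else 0) - openEulerChar (algRelint G) := by
    intro G hG
    rcases G.eq_empty_or_nonempty with rfl | hne
    · rw [if_pos rfl, if_pos rfl, Set.subset_empty_iff.1 (algRelint_subset (∅ : Set V)),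
        openEulerChar_empty, pow_zero, sub_zero]
    · have hconv := IsExposed.convex hG (convex_convexHull ℝ _)
      have hne' := hconv.algRelint_nonempty hne
      rw [if_neg hne.ne_empty, if_neg hne.ne_empty, openEulerChar, if_neg hne'.ne_empty,
        hconv.vectorSpan_algRelint hne', pow_succ]
      ring
  by_contra! hcon
  obtain ⟨F, hF⟩ := ((finite_isExposed_convexHull s).subset fun _ h ↦ h.1).exists_minimal hcon
  obtain ⟨hFe, hFne⟩ := hF.prop
  have hne : F.Nonempty := by
    by_contra h
    rw [Set.not_nonempty_iff_eq_empty] at h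
    exact hFne (by simp [h, hbot])
  have hfin : {G | IsExposed ℝ (convexHull ℝ (s : Set V)) G ∧ G ⊆ F}.Finite :=
    (finite_isExposed_convexHull s).subset fun _ h ↦ h.1
  have hmem : ∀ G, G ∈ hfin.toFinset ↔ IsExposed ℝ (convexHull ℝ (s : Set V)) G ∧ G ⊆ F :=
    fun G ↦ hfin.mem_toFinset
  have hFI := (hmem F).2 ⟨hFe, subset_rfl⟩
  have hμ := hrec F hFe hne
  rw [finsum_mem_eq_finite_toFinset_sum _ hfin, ← Finset.add_sum_erase _ _ hFI] at hμ
  have hsum : ∑ G ∈ hfin.toFinset,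
      (-1 : ℝ) ^ (if G = ∅ then 0 else Module.finrank ℝ (vectorSpan ℝ G) + 1) = 0 := by
    rw [Finset.sum_congr rfl fun G hG ↦ hsign G ((hmem G).1 hG).1, Finset.sum_sub_distrib,
      hFe.sum_openEulerChar_algRelint hne hmem, Finset.sum_ite_eq',
      if_pos ((hmem ∅).2 ⟨isExposed_empty, Set.empty_subset F⟩), sub_self]
  rw [← Finset.add_sum_erase _ _ hFI] at hsum
  refine hFne (add_right_cancel (hμ.trans ?_))
  rw [← hsum]
  congr 1
  refine Finset.sum_congr rfl fun G hG ↦ ?_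
  rw [Finset.mem_erase, hmem] at hG
  by_contra hGne
  exact hG.1 (hG.2.2.antisymm (hF.le_of_le ⟨hG.2.1, fun h ↦ hGne h.symm⟩ hG.2.2))
end

section
/- The unique multilinear polynomial over the reals representing the bipartite perfect matching function BPM_n is BPM_n(x) = Σ_{G ∈ MC_n} (−1)^{χ(G)} Π_{(i,j)∈E(G)} x_{i,j}, where the sum is over all matching-covered subgraphs of K_{n,n} and χ is the cyclomatic number. -/
open Finset
open scoped Classical

/-- Edges of the complete bipartite graph `K_{n,n}` on labeled parts of size `n`. -/
abbrev Edge (n : ℕ) := Fin n × Fin n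

/-- `M` is (the edge set of) a perfect matching of `K_{n,n}`. -/
def isPM {n : ℕ} (M : Finset (Edge n)) : Prop :=
  ∃ σ : Equiv.Perm (Fin n), M = Finset.univ.image fun i => (i, σ i)

/-- `G` is matching-covered: its edge set is a (nonempty) union of perfect matchings. -/
def matchingCovered {n : ℕ} (G : Finset (Edge n)) : Prop :=
  ∃ S : Finset (Finset (Edge n)), S.Nonempty ∧ (∀ M ∈ S, isPM M) ∧ S.sup id = G

/-- `G` contains a perfect matching. -/
def hasPM {n : ℕ} (G : Finset (Edge n)) : Prop :=
  ∃ σ : Equiv.Perm (Fin n), ∀ i, (i, σ i) ∈ G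

/-- The bipartite graph on the vertex set `Fin n ⊕ Fin n` with edge set `G`. -/
def graphOn {n : ℕ} (G : Finset (Edge n)) : SimpleGraph (Fin n ⊕ Fin n) :=
  SimpleGraph.fromRel fun u v => ∃ e ∈ G, u = Sum.inl e.1 ∧ v = Sum.inr e.2

/-- The number of connected components of `G` (as a spanning subgraph of `K_{n,n}`). -/
noncomputable def numComponents {n : ℕ} (G : Finset (Edge n)) : ℕ :=
  Nat.card (graphOn G).ConnectedComponent

/-- The cyclomatic number `χ(G) = |E(G)| − |V(G)| + |C(G)|`. -/
noncomputable def cyclo {n : ℕ} (G : Finset (Edge n)) : ℤ :=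
  (G.card : ℤ) + numComponents G - 2 * n

/-- `G` is elementary: a connected matching-covered graph. -/
def elementary {n : ℕ} (G : Finset (Edge n)) : Prop :=
  matchingCovered G ∧ (graphOn G).Connected

/-- The bipartite perfect matching decision function, on inputs `x : Edge n → Bool`. -/
def BPMb (n : ℕ) (x : Edge n → Bool) : Prop :=
  ∃ σ : Equiv.Perm (Fin n), ∀ i, x (i, σ i) = true

section EulerIntegral

open Filter Topology

/-- `z` is the integral of `g : ℝ → ℤ` with respect to the Euler characteristic: the sum of the
drops from the values of `g` to its right limits. -/
def HasEulerSum (g : ℝ → ℤ) (z : ℤ) : Prop :=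
  ∃ r : ℝ → ℤ, (∀ t, ∀ᶠ s in 𝓝[>] t, g s = r t) ∧
    (Function.support (g - r)).Finite ∧ ∑ᶠ t, (g - r) t = z

/-- `z` is the iterated Euler integral of `f` over the coordinates in the list, the other
coordinates being fixed to those of `x`. -/
def HasEulerIntegral {ι : Type*} [DecidableEq ι] :
    List ι → ((ι → ℝ) → ℤ) → (ι → ℝ) → ℤ → Prop
  | [], f, x, z => f x = z
  | i :: l, f, x, z =>
    ∃ g : ℝ → ℤ, (∀ t, HasEulerIntegral l f (Function.update x i t) (g t)) ∧ HasEulerSum g z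

/-- The points of `C` that agree with `x` outside the coordinates in `l`. -/
def coordFiber {ι : Type*} (C : Set (ι → ℝ)) (x : ι → ℝ) (l : List ι) : Set (ι → ℝ) :=
  {y | y ∈ C ∧ ∀ i, i ∉ l → y i = x i}

/-- The vectors of `W` supported on the coordinates in `l`. -/
def coordSubmodule {ι : Type*} (W : Submodule ℝ (ι → ℝ)) (l : List ι) :
    Submodule ℝ (ι → ℝ) where
  carrier := {w | w ∈ W ∧ ∀ i, i ∉ l → w i = 0}
  add_mem' ha hb := ⟨W.add_mem ha.1 hb.1, fun i hi => by simp [ha.2 i hi, hb.2 i hi]⟩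
  zero_mem' := ⟨W.zero_mem, fun _ _ => rfl⟩
  smul_mem' c _ ha := ⟨W.smul_mem c ha.1, fun i hi => by simp [ha.2 i hi]⟩

namespace HasEulerSum

theorem zero : HasEulerSum (fun _ => 0) 0 :=
  ⟨fun _ => 0, fun _ => by simp, by simp [Function.support], by simp⟩

theorem add {g g' : ℝ → ℤ} {z z' : ℤ} (h : HasEulerSum g z) (h' : HasEulerSum g' z') :
    HasEulerSum (fun t => g t + g' t) (z + z') := by
  obtain ⟨r, hr, hf, rfl⟩ := h
  obtain ⟨r', hr', hf', rfl⟩ := h'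
  have key : ((fun t => g t + g' t) - (r + r') : ℝ → ℤ) = (g - r) + (g' - r') := by
    ext t; simp; ring
  refine ⟨r + r', fun t => ?_, ?_, ?_⟩
  · filter_upwards [hr t, hr' t] with s h1 h2
    simp [h1, h2]
  · rw [key]
    exact (hf.union hf').subset (Function.support_add _ _)
  · rw [key, ← finsum_add_distrib hf hf']
    rfl

theorem unique {g : ℝ → ℤ} {z z' : ℤ} (h : HasEulerSum g z) (h' : HasEulerSum g z') :
    z = z' := by
  obtain ⟨r, hr, -, rfl⟩ := h
  obtain ⟨r', hr', -, rfl⟩ := h'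
  have : r = r' := by
    ext t
    obtain ⟨s, h1, h2⟩ := ((hr t).and (hr' t)).exists
    exact h1.symm.trans h2
  rw [this]

theorem of_single_drop {g r : ℝ → ℤ} (a : ℝ) (hr : ∀ t, ∀ᶠ s in 𝓝[>] t, g s = r t)
    (h : ∀ t, t ≠ a → g t = r t) : HasEulerSum g (g a - r a) := by
  refine ⟨r, hr, (Set.finite_singleton a).subset fun t ht => ?_, ?_⟩
  · by_contra hne
    exact ht (by simp [h t hne])
  · rw [finsum_eq_single _ a fun t ht => by simp [h t ht]]
    rfl

theorem indicator_singleton (a : ℝ) (c : ℤ) :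
    HasEulerSum (({a} : Set ℝ).indicator fun _ => c) c := by
  have := of_single_drop (g := ({a} : Set ℝ).indicator fun _ => c) (r := fun _ => 0) a
    (fun t => ?_) (fun t ht => by simp [ht])
  · simpa using this
  · rcases lt_or_ge t a with h | h
    · filter_upwards [Ioo_mem_nhdsGT h] with s hs
      simp [hs.2.ne]
    · filter_upwards [self_mem_nhdsWithin] with s hs
      simp [(lt_of_le_of_lt h hs).ne']

theorem eventually_nhdsGT_indicator {a b : ℝ} {T : Set ℝ} (h₁ : Set.Ioo a b ⊆ T)
    (h₂ : T ⊆ Set.Icc a b) (c : ℤ) (t : ℝ) :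
    ∀ᶠ s in 𝓝[>] t, T.indicator (fun _ => c) s = (Set.Ico a b).indicator (fun _ => c) t := by
  rcases lt_or_ge t a with h | h
  · filter_upwards [Ioo_mem_nhdsGT h] with s hs
    rw [Set.indicator_of_notMem fun hT => hs.2.not_ge (h₂ hT).1,
      Set.indicator_of_notMem fun hT => h.not_ge hT.1]
  · rcases lt_or_ge t b with h' | h'
    · filter_upwards [Ioo_mem_nhdsGT h'] with s hs
      rw [Set.indicator_of_mem (h₁ ⟨h.trans_lt hs.1, hs.2⟩),
        Set.indicator_of_mem (Set.mem_Ico.2 ⟨h, h'⟩)]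
    · filter_upwards [self_mem_nhdsWithin] with s hs
      rw [Set.indicator_of_notMem fun hT => (h'.trans_lt hs).not_ge (h₂ hT).2,
        Set.indicator_of_notMem fun hT => h'.not_gt hT.2]

theorem indicator_Icc {a b : ℝ} (hab : a ≤ b) (c : ℤ) :
    HasEulerSum ((Set.Icc a b).indicator fun _ => c) c := by
  have := of_single_drop (g := (Set.Icc a b).indicator fun _ => c) b
    (eventually_nhdsGT_indicator Set.Ioo_subset_Icc_self subset_rfl c)
    (fun t ht => by
      have : t ∈ Set.Icc a b ↔ t ∈ Set.Ico a b :=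
        ⟨fun h => ⟨h.1, lt_of_le_of_ne h.2 ht⟩, fun h => ⟨h.1, h.2.le⟩⟩
      simp only [Set.indicator, this])
  simpa [hab] using this

theorem indicator_Ioo {a b : ℝ} (hab : a < b) (c : ℤ) :
    HasEulerSum ((Set.Ioo a b).indicator fun _ => c) (-c) := by
  have := of_single_drop (g := (Set.Ioo a b).indicator fun _ => c) a
    (eventually_nhdsGT_indicator subset_rfl Set.Ioo_subset_Icc_self c)
    (fun t ht => by
      have : t ∈ Set.Ioo a b ↔ t ∈ Set.Ico a b :=
        ⟨fun h => ⟨h.1.le, h.2⟩, fun h => ⟨lt_of_le_of_ne h.1 ht.symm, h.2⟩⟩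
      simp only [Set.indicator, this])
  simpa [hab] using this

end HasEulerSum

namespace HasEulerIntegral

variable {ι : Type*} [DecidableEq ι]

theorem zero (l : List ι) (x : ι → ℝ) : HasEulerIntegral l (fun _ => 0) x 0 := by
  induction l generalizing x with
  | nil => rfl
  | cons i l ih => exact ⟨fun _ => 0, fun t => ih _, HasEulerSum.zero⟩

theorem add {l : List ι} {f f' : (ι → ℝ) → ℤ} {x : ι → ℝ} {z z' : ℤ}
    (h : HasEulerIntegral l f x z) (h' : HasEulerIntegral l f' x z') :
    HasEulerIntegral l (fun y => f y + f' y) x (z + z') := by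
  induction l generalizing x z z' with
  | nil => exact congrArg₂ (· + ·) h h'
  | cons i l ih =>
    obtain ⟨g, hg, hz⟩ := h
    obtain ⟨g', hg', hz'⟩ := h'
    exact ⟨fun t => g t + g' t, fun t => ih (hg t) (hg' t), hz.add hz'⟩

theorem sum {κ : Type*} {l : List ι} {x : ι → ℝ} (s : Finset κ) {f : κ → (ι → ℝ) → ℤ}
    {z : κ → ℤ} (h : ∀ k ∈ s, HasEulerIntegral l (f k) x (z k)) :
    HasEulerIntegral l (fun y => ∑ k ∈ s, f k y) x (∑ k ∈ s, z k) := by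
  induction s using Finset.induction_on with
  | empty => simpa using zero l x
  | insert a s ha ih =>
    simp only [Finset.sum_insert ha]
    exact (h a (Finset.mem_insert_self a s)).add
      (ih fun k hk => h k (Finset.mem_insert_of_mem hk))

theorem unique {l : List ι} {f : (ι → ℝ) → ℤ} {x : ι → ℝ} {z z' : ℤ}
    (h : HasEulerIntegral l f x z) (h' : HasEulerIntegral l f x z') : z = z' := by
  induction l generalizing x z z' with
  | nil => exact h.symm.trans h'
  | cons i l ih =>
    obtain ⟨g, hg, hz⟩ := h
    obtain ⟨g', hg', hz'⟩ := h'
    obtain rfl : g = g' := funext fun t => ih (hg t) (hg' t)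
    exact hz.unique hz'

end HasEulerIntegral

section Fibers

variable {ι : Type*}

theorem mem_coordFiber_update [DecidableEq ι] {C : Set (ι → ℝ)} {x y : ι → ℝ} {i : ι} {l : List ι}
    (hi : i ∉ l) {t : ℝ} :
    y ∈ coordFiber C (Function.update x i t) l ↔ y ∈ coordFiber C x (i :: l) ∧ y i = t := by
  constructor
  · rintro ⟨hy, h⟩
    refine ⟨⟨hy, fun j hj => ?_⟩, by simpa using h i hi⟩
    rw [List.mem_cons, not_or] at hj
    simpa [hj.1] using h j hj.2
  · rintro ⟨⟨hy, h⟩, rfl⟩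
    refine ⟨hy, fun j hj => ?_⟩
    rcases eq_or_ne j i with rfl | hne
    · simp
    · simpa [hne] using h j (by simp [hne, hj])

theorem coordFiber_update_nonempty_iff [DecidableEq ι] {C : Set (ι → ℝ)} {x : ι → ℝ}
    {i : ι} {l : List ι} (hi : i ∉ l) {t : ℝ} :
    (coordFiber C (Function.update x i t) l).Nonempty ↔
      t ∈ (fun y : ι → ℝ => y i) '' coordFiber C x (i :: l) :=
  exists_congr fun _ => mem_coordFiber_update hi

theorem coordFiber_nil_nonempty_iff {C : Set (ι → ℝ)} {x : ι → ℝ} :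
    (coordFiber C x []).Nonempty ↔ x ∈ C := by
  refine ⟨fun ⟨y, hy, h⟩ => ?_, fun h => ⟨x, h, fun _ _ => rfl⟩⟩
  obtain rfl : y = x := funext fun i => h i List.not_mem_nil
  exact hy

theorem convex_coordFiber {C : Set (ι → ℝ)} (hC : Convex ℝ C) (x : ι → ℝ) (l : List ι) :
    Convex ℝ (coordFiber C x l) := by
  intro y hy y' hy' a b ha hb hab
  refine ⟨hC hy.1 hy'.1 ha hb hab, fun i hi => ?_⟩
  simp [hy.2 i hi, hy'.2 i hi, ← add_mul, hab]

theorem isCompact_coordFiber {C : Set (ι → ℝ)} (hC : IsCompact C) (x : ι → ℝ) (l : List ι) :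
    IsCompact (coordFiber C x l) := by
  have : IsClosed {y : ι → ℝ | ∀ i, i ∉ l → y i = x i} := by
    simp only [Set.ofPred_forall]
    exact isClosed_iInter fun i => isClosed_iInter fun _ =>
      isClosed_eq (continuous_apply i) continuous_const
  exact hC.inter_right this

/-- The Euler integral of the indicator of a compact convex set is `1` if it is nonempty. -/
theorem hasEulerIntegral_of_isCompact [DecidableEq ι] {C : Set (ι → ℝ)} (hC : Convex ℝ C)
    (hK : IsCompact C)
    {l : List ι} (hl : l.Nodup) (x : ι → ℝ) :
    HasEulerIntegral l (C.indicator fun _ => 1) x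
      (if (coordFiber C x l).Nonempty then 1 else 0) := by
  induction l generalizing x with
  | nil => simp [HasEulerIntegral, coordFiber_nil_nonempty_iff, Set.indicator]
  | cons i l ih =>
    obtain ⟨hi, hl⟩ := List.nodup_cons.1 hl
    refine ⟨_, fun t => ih hl _, ?_⟩
    simp only [coordFiber_update_nonempty_iff hi]
    split_ifs with hne
    · have hcon : IsConnected ((fun y : ι → ℝ => y i) '' coordFiber C x (i :: l)) :=
        ((convex_coordFiber hC x _).isConnected hne).image _ (continuous_apply i).continuousOn
      have hcpt := (isCompact_coordFiber hK x (i :: l)).image (continuous_apply i)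
      have := eq_Icc_of_connected_compact hcon hcpt
      rw [this]
      refine HasEulerSum.indicator_Icc ?_ 1
      exact Set.nonempty_Icc.1 (this ▸ hne.image _)
    · rw [Set.not_nonempty_iff_eq_empty.1 hne]
      simpa using HasEulerSum.zero

theorem mem_coordSubmodule_iff_cons {W : Submodule ℝ (ι → ℝ)} {i : ι} {l : List ι}
    (hi : i ∉ l) {w : ι → ℝ} :
    w ∈ coordSubmodule W l ↔ w ∈ coordSubmodule W (i :: l) ∧ w i = 0 := by
  constructor
  · rintro ⟨hw, h⟩
    exact ⟨⟨hw, fun j hj => h j fun hj' => hj (List.mem_cons_of_mem _ hj')⟩, h i hi⟩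
  · rintro ⟨⟨hw, h⟩, h0⟩
    refine ⟨hw, fun j hj => ?_⟩
    rcases eq_or_ne j i with rfl | hne
    · exact h0
    · exact h j (by simp [hne, hj])

theorem finrank_coordSubmodule_cons [Finite ι] {W : Submodule ℝ (ι → ℝ)} {i : ι} {l : List ι}
    (hi : i ∉ l) {w : ι → ℝ} (hw : w ∈ coordSubmodule W (i :: l)) (hwi : w i ≠ 0) :
    Module.finrank ℝ (coordSubmodule W (i :: l)) =
      Module.finrank ℝ (coordSubmodule W l) + 1 := by
  set K := coordSubmodule W (i :: l) with hK
  let f : Module.Dual ℝ K := (LinearMap.proj i : (ι → ℝ) →ₗ[ℝ] ℝ) ∘ₗ K.subtype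
  have hf : f ≠ 0 := fun h => hwi (LinearMap.congr_fun h ⟨w, hw⟩)
  have hmap : coordSubmodule W l = (LinearMap.ker f).map K.subtype := by
    ext v
    rw [mem_coordSubmodule_iff_cons hi, Submodule.mem_map]
    constructor
    · rintro ⟨hv, h0⟩
      exact ⟨⟨v, hv⟩, h0, rfl⟩
    · rintro ⟨⟨v, hv⟩, h0, rfl⟩
      exact ⟨hv, h0⟩
  rw [hmap, Submodule.finrank_map_subtype_eq, Module.Dual.finrank_ker_add_one_of_ne_zero hf]

theorem exists_add_smul_mem_coordFiber {C : Set (ι → ℝ)} {W : Submodule ℝ (ι → ℝ)}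
    (hW : ∀ y ∈ C, ∀ w ∈ W, ∃ ε : ℝ, 0 < ε ∧ y + ε • w ∈ C) {x y w : ι → ℝ} {l : List ι}
    (hy : y ∈ coordFiber C x l) (hw : w ∈ coordSubmodule W l) :
    ∃ ε : ℝ, 0 < ε ∧ y + ε • w ∈ coordFiber C x l := by
  obtain ⟨ε, hε, h⟩ := hW y hy.1 w hw.1
  exact ⟨ε, hε, h, fun i hi => by simp [hy.2 i hi, hw.2 i hi]⟩

theorem eq_Ioo_of_isConnected_of_forall_exists {T : Set ℝ} (hT : IsConnected T)
    (hb : BddBelow T) (ha : BddAbove T) (hlt : ∀ t ∈ T, ∃ s ∈ T, s < t)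
    (hgt : ∀ t ∈ T, ∃ s ∈ T, t < s) : T = Set.Ioo (sInf T) (sSup T) := by
  refine Set.Subset.antisymm (fun t ht => ?_) (hT.Ioo_csInf_csSup_subset hb ha)
  obtain ⟨s, hs, hst⟩ := hlt t ht
  obtain ⟨u, hu, htu⟩ := hgt t ht
  exact ⟨(csInf_le hb hs).trans_lt hst, htu.trans_le (le_csSup ha hu)⟩

/-- The Euler integral of the indicator of a nonempty bounded convex set that is open in an
affine subspace with direction `W` is `(-1) ^ dim W`. -/
theorem hasEulerIntegral_of_relativelyOpen [DecidableEq ι] [Fintype ι] {C : Set (ι → ℝ)}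
    {W : Submodule ℝ (ι → ℝ)} (hC : Convex ℝ C) (hb : Bornology.IsBounded C)
    (hsub : ∀ y ∈ C, ∀ y' ∈ C, y - y' ∈ W)
    (hW : ∀ y ∈ C, ∀ w ∈ W, ∃ ε : ℝ, 0 < ε ∧ y + ε • w ∈ C)
    {l : List ι} (hl : l.Nodup) (x : ι → ℝ) :
    HasEulerIntegral l (C.indicator fun _ => 1) x
      (if (coordFiber C x l).Nonempty
        then (-1) ^ Module.finrank ℝ (coordSubmodule W l) else 0) := by
  induction l generalizing x with
  | nil =>
    have : coordSubmodule W [] = ⊥ :=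
      (Submodule.eq_bot_iff _).2 fun w hw => funext fun i => hw.2 i List.not_mem_nil
    rw [this]
    simp [HasEulerIntegral, coordFiber_nil_nonempty_iff, Set.indicator]
  | cons i l ih =>
    obtain ⟨hi, hl⟩ := List.nodup_cons.1 hl
    refine ⟨_, fun t => ih hl _, ?_⟩
    simp only [coordFiber_update_nonempty_iff hi]
    split_ifs with hne
    · by_cases hker : ∀ w ∈ coordSubmodule W (i :: l), w i = 0
      · obtain ⟨y, hy⟩ := hne
        have himage : (fun y : ι → ℝ => y i) '' coordFiber C x (i :: l) = {y i} := by
          refine Set.Subset.antisymm ?_ (Set.singleton_subset_iff.2 ⟨y, hy, rfl⟩)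
          rintro _ ⟨y', hy', rfl⟩
          refine sub_eq_zero.1 (hker (y' - y) ⟨hsub _ hy'.1 _ hy.1, fun j hj => ?_⟩)
          simp [hy.2 j hj, hy'.2 j hj]
        have hsame : coordSubmodule W l = coordSubmodule W (i :: l) := by
          ext w
          rw [mem_coordSubmodule_iff_cons hi]
          exact and_iff_left_of_imp (hker w)
        rw [himage, hsame]
        exact HasEulerSum.indicator_singleton _ _
      · push Not at hker
        obtain ⟨w, hw, hwi⟩ := hker
        have hcon : IsConnected ((fun y : ι → ℝ => y i) '' coordFiber C x (i :: l)) :=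
          ((convex_coordFiber hC x _).isConnected hne).image _ (continuous_apply i).continuousOn
        have hbdd : Bornology.IsBounded ((fun y : ι → ℝ => y i) '' coordFiber C x (i :: l)) :=
          (hb.subset fun _ hy => hy.1).image_eval i
        have hmove : ∀ v ∈ coordSubmodule W (i :: l),
            ∀ t ∈ (fun y : ι → ℝ => y i) '' coordFiber C x (i :: l),
            ∃ ε : ℝ, 0 < ε ∧
              t + ε * v i ∈ (fun y : ι → ℝ => y i) '' coordFiber C x (i :: l) := by
          rintro v hv _ ⟨y, hy, rfl⟩
          obtain ⟨ε, hε, h⟩ := exists_add_smul_mem_coordFiber hW hy hv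
          exact ⟨ε, hε, _, h, by simp⟩
        have heq := eq_Ioo_of_isConnected_of_forall_exists hcon hbdd.bddBelow hbdd.bddAbove
          (fun t ht => by
            obtain ⟨ε, hε, h⟩ := hmove (-(w i) • w) (Submodule.smul_mem _ _ hw) t ht
            refine ⟨_, h, ?_⟩
            have := mul_pos hε (mul_self_pos.2 hwi)
            simp only [Pi.smul_apply, smul_eq_mul]
            linarith)
          (fun t ht => by
            obtain ⟨ε, hε, h⟩ := hmove (w i • w) (Submodule.smul_mem _ _ hw) t ht
            refine ⟨_, h, ?_⟩
            have := mul_pos hε (mul_self_pos.2 hwi)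
            simp only [Pi.smul_apply, smul_eq_mul]
            linarith)
        have hlt := Set.nonempty_Ioo.1 (heq ▸ hne.image fun y : ι → ℝ => y i)
        rw [heq, finrank_coordSubmodule_cons hi hw hwi, pow_succ, mul_neg_one]
        exact HasEulerSum.indicator_Ioo hlt _
    · rw [Set.not_nonempty_iff_eq_empty.1 hne]
      simpa using HasEulerSum.zero

end Fibers

end EulerIntegral

section PerfectMatchings

variable {n : ℕ}

/-- The points of the Birkhoff polytope whose support is contained in `H`. -/
def birkhoffFace (H : Finset (Edge n)) : Set (Edge n → ℝ) :=
  {y | (∀ i, ∑ j, y (i, j) = 1) ∧ (∀ j, ∑ i, y (i, j) = 1) ∧ (∀ e, 0 ≤ y e) ∧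
    ∀ e, e ∉ H → y e = 0}

/-- The points of the Birkhoff polytope whose support is exactly `G`. -/
def birkhoffOpenFace (G : Finset (Edge n)) : Set (Edge n → ℝ) :=
  {y | (∀ i, ∑ j, y (i, j) = 1) ∧ (∀ j, ∑ i, y (i, j) = 1) ∧ (∀ e ∈ G, 0 < y e) ∧
    ∀ e, e ∉ G → y e = 0}

/-- The edge weightings supported on `G` with zero weight at each vertex. -/
def flowSpace (G : Finset (Edge n)) : Submodule ℝ (Edge n → ℝ) where
  carrier := {w | (∀ i, ∑ j, w (i, j) = 0) ∧ (∀ j, ∑ i, w (i, j) = 0) ∧ ∀ e, e ∉ G → w e = 0}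
  add_mem' ha hb := ⟨fun i => by simp [Finset.sum_add_distrib, ha.1, hb.1],
    fun j => by simp [Finset.sum_add_distrib, ha.2.1, hb.2.1],
    fun e he => by simp [ha.2.2 e he, hb.2.2 e he]⟩
  zero_mem' := by simp
  smul_mem' c w hw := ⟨fun i => by simp [← Finset.mul_sum, hw.1],
    fun j => by simp [← Finset.mul_sum, hw.2.1], fun e he => by simp [hw.2.2 e he]⟩

theorem birkhoffOpenFace_subset (G : Finset (Edge n)) : birkhoffOpenFace G ⊆ birkhoffFace G := by
  rintro y ⟨hr, hc, hp, h0⟩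
  refine ⟨hr, hc, fun e => ?_, h0⟩
  by_cases he : e ∈ G
  · exact (hp e he).le
  · exact (h0 e he).ge

theorem birkhoffFace_subset_Icc (H : Finset (Edge n)) : birkhoffFace H ⊆ Set.Icc 0 1 := by
  rintro y ⟨hr, -, hp, -⟩
  refine ⟨hp, fun e => ?_⟩
  have := Finset.single_le_sum (f := fun j => y (e.1, j)) (fun j _ => hp _) (Finset.mem_univ e.2)
  exact this.trans (hr e.1).le

theorem isCompact_birkhoffFace (H : Finset (Edge n)) : IsCompact (birkhoffFace H) := by
  refine isCompact_Icc.of_isClosed_subset ?_ (birkhoffFace_subset_Icc H)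
  simp only [birkhoffFace, Set.ofPred_and, Set.ofPred_forall]
  refine IsClosed.inter (isClosed_iInter fun i => isClosed_eq (by fun_prop) (by fun_prop)) <|
    IsClosed.inter (isClosed_iInter fun j => isClosed_eq (by fun_prop) (by fun_prop)) <|
    IsClosed.inter (isClosed_iInter fun e => isClosed_le (by fun_prop) (by fun_prop)) <|
    isClosed_iInter fun e => isClosed_iInter fun _ => isClosed_eq (by fun_prop) (by fun_prop)

theorem convex_birkhoffFace (H : Finset (Edge n)) : Convex ℝ (birkhoffFace H) := by
  rintro y ⟨hr, hc, hp, h0⟩ y' ⟨hr', hc', hp', h0'⟩ a b ha hb hab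
  refine ⟨fun i => ?_, fun j => ?_, fun e => ?_, fun e he => ?_⟩
  · simp [Finset.sum_add_distrib, ← Finset.mul_sum, hr, hr', hab]
  · simp [Finset.sum_add_distrib, ← Finset.mul_sum, hc, hc', hab]
  · exact add_nonneg (mul_nonneg ha (hp e)) (mul_nonneg hb (hp' e))
  · simp [h0 e he, h0' e he]

theorem convex_birkhoffOpenFace (G : Finset (Edge n)) : Convex ℝ (birkhoffOpenFace G) := by
  rintro y ⟨hr, hc, hp, h0⟩ y' ⟨hr', hc', hp', h0'⟩ a b ha hb hab
  refine ⟨fun i => ?_, fun j => ?_, fun e he => ?_, fun e he => ?_⟩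
  · simp [Finset.sum_add_distrib, ← Finset.mul_sum, hr, hr', hab]
  · simp [Finset.sum_add_distrib, ← Finset.mul_sum, hc, hc', hab]
  · exact convex_Ioi (𝕜 := ℝ) (0 : ℝ) (hp e he) (hp' e he) ha hb hab
  · simp [h0 e he, h0' e he]

theorem sub_mem_flowSpace {G : Finset (Edge n)} {y y' : Edge n → ℝ}
    (hy : y ∈ birkhoffOpenFace G) (hy' : y' ∈ birkhoffOpenFace G) : y - y' ∈ flowSpace G :=
  ⟨fun i => by simp [hy.1, hy'.1], fun j => by simp [hy.2.1, hy'.2.1],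
    fun e he => by simp [hy.2.2.2 e he, hy'.2.2.2 e he]⟩

open Filter Topology in
theorem exists_add_smul_mem_birkhoffOpenFace {G : Finset (Edge n)} {y w : Edge n → ℝ}
    (hy : y ∈ birkhoffOpenFace G) (hw : w ∈ flowSpace G) :
    ∃ ε : ℝ, 0 < ε ∧ y + ε • w ∈ birkhoffOpenFace G := by
  have hev : ∀ᶠ ε in 𝓝[>] (0 : ℝ), ∀ e ∈ G, 0 < y e + ε * w e := by
    refine (Filter.eventually_all_finset G).2 fun e he => ?_
    have hcont : Continuous fun ε : ℝ => y e + ε * w e := by fun_prop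
    refine (hcont.tendsto 0).mono_left nhdsWithin_le_nhds |>.eventually (lt_mem_nhds ?_)
    simpa using hy.2.2.1 e he
  obtain ⟨ε, h, hε⟩ := (hev.and self_mem_nhdsWithin).exists
  refine ⟨ε, hε, fun i => ?_, fun j => ?_, h, fun e he => ?_⟩
  · simp [Finset.sum_add_distrib, ← Finset.mul_sum, hy.1, hw.1]
  · simp [Finset.sum_add_distrib, ← Finset.mul_sum, hy.2.1, hw.2.1]
  · simp [hy.2.2.2 e he, hw.2.2 e he]

theorem mem_birkhoffOpenFace_iff {H G : Finset (Edge n)} (hG : G ⊆ H) {y : Edge n → ℝ} :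
    y ∈ birkhoffOpenFace G ↔
      y ∈ birkhoffFace H ∧ G = Finset.univ.filter fun e => 0 < y e := by
  constructor
  · intro hy
    have hy' := birkhoffOpenFace_subset G hy
    refine ⟨⟨hy.1, hy.2.1, hy'.2.2.1, fun e he => hy'.2.2.2 e fun h => he (hG h)⟩, ?_⟩
    ext e
    by_cases he : e ∈ G
    · simp [he, hy.2.2.1 e he]
    · simp [he, hy.2.2.2 e he]
  · rintro ⟨⟨hr, hc, hp, -⟩, rfl⟩
    exact ⟨hr, hc, fun e he => (Finset.mem_filter.1 he).2,
      fun e he => le_antisymm (by simpa using he) (hp e)⟩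

theorem indicator_birkhoffFace (H : Finset (Edge n)) (y : Edge n → ℝ) :
    (birkhoffFace H).indicator (fun _ => (1 : ℤ)) y =
      ∑ G ∈ H.powerset, (birkhoffOpenFace G).indicator (fun _ => 1) y := by
  by_cases hy : y ∈ birkhoffFace H
  · have hmem : (Finset.univ.filter fun e => 0 < y e) ∈ H.powerset := by
      refine Finset.mem_powerset.2 fun e he => ?_
      by_contra heH
      simp [hy.2.2.2 e heH] at he
    rw [Finset.sum_eq_single_of_mem _ hmem, Set.indicator_of_mem hy, Set.indicator_of_mem]
    · exact (mem_birkhoffOpenFace_iff (Finset.mem_powerset.1 hmem)).2 ⟨hy, rfl⟩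
    · intro G hG hne
      exact Set.indicator_of_notMem
        (fun h => hne ((mem_birkhoffOpenFace_iff (Finset.mem_powerset.1 hG)).1 h).2) _
  · rw [Set.indicator_of_notMem hy, Finset.sum_eq_zero]
    intro G hG
    exact Set.indicator_of_notMem
      (fun h => hy ((mem_birkhoffOpenFace_iff (Finset.mem_powerset.1 hG)).1 h).1) _

/-- The Euler relation for a face of the Birkhoff polytope. -/
theorem sum_neg_one_pow_finrank_flowSpace (H : Finset (Edge n)) :
    (∑ G ∈ H.powerset, if (birkhoffOpenFace G).Nonempty
      then (-1 : ℤ) ^ Module.finrank ℝ (flowSpace G) else 0) =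
      if (birkhoffFace H).Nonempty then 1 else 0 := by
  have hfib : ∀ C : Set (Edge n → ℝ), coordFiber C 0 Finset.univ.toList = C := fun C => by
    ext y; simp [coordFiber]
  have hrank : ∀ W : Submodule ℝ (Edge n → ℝ),
      Module.finrank ℝ (coordSubmodule W Finset.univ.toList) = Module.finrank ℝ W := fun W => by
    rw [show coordSubmodule W Finset.univ.toList = W by ext w; simp [coordSubmodule]]
  have hnd := Finset.nodup_toList (Finset.univ : Finset (Edge n))
  have hface := hasEulerIntegral_of_isCompact (convex_birkhoffFace H) (isCompact_birkhoffFace H)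
    hnd 0
  have hopen := HasEulerIntegral.sum H.powerset fun G (_ : G ∈ H.powerset) =>
    hasEulerIntegral_of_relativelyOpen (convex_birkhoffOpenFace G)
      ((Metric.isBounded_Icc 0 1).subset
        ((birkhoffOpenFace_subset G).trans (birkhoffFace_subset_Icc G)))
      (fun _ hy _ hy' => sub_mem_flowSpace hy hy')
      (fun _ hy _ hw => exists_add_smul_mem_birkhoffOpenFace hy hw) hnd 0
  simp only [hfib, hrank, ← indicator_birkhoffFace] at hface hopen
  exact hopen.unique hface

theorem mem_perm_image {σ : Equiv.Perm (Fin n)} {e : Edge n} :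
    e ∈ Finset.univ.image (fun i => (i, σ i)) ↔ σ e.1 = e.2 := by
  constructor
  · intro h
    obtain ⟨i, -, rfl⟩ := Finset.mem_image.1 h
    rfl
  · intro h
    exact Finset.mem_image.2 ⟨e.1, Finset.mem_univ _, Prod.ext rfl h⟩

theorem sum_row_isPM {M : Finset (Edge n)} (hM : isPM M) (i : Fin n) :
    ∑ j, (if (i, j) ∈ M then (1 : ℝ) else 0) = 1 := by
  obtain ⟨σ, rfl⟩ := hM
  simp only [mem_perm_image]
  simp

theorem sum_col_isPM {M : Finset (Edge n)} (hM : isPM M) (j : Fin n) :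
    ∑ i, (if (i, j) ∈ M then (1 : ℝ) else 0) = 1 := by
  obtain ⟨σ, rfl⟩ := hM
  simp only [mem_perm_image, ← Equiv.eq_symm_apply]
  simp

theorem matchingCovered_iff_nonempty {G : Finset (Edge n)} :
    matchingCovered G ↔ (birkhoffOpenFace G).Nonempty := by
  constructor
  · rintro ⟨S, hne, hS, rfl⟩
    have hcard : (0 : ℝ) < S.card := by exact_mod_cast hne.card_pos
    refine ⟨fun e => (S.card : ℝ)⁻¹ * ∑ M ∈ S, if e ∈ M then 1 else 0,
      fun i => ?_, fun j => ?_, fun e he => ?_, fun e he => ?_⟩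
    · rw [← Finset.mul_sum, Finset.sum_comm,
        Finset.sum_congr rfl fun M hM => sum_row_isPM (hS M hM) i]
      simp [hcard.ne']
    · rw [← Finset.mul_sum, Finset.sum_comm,
        Finset.sum_congr rfl fun M hM => sum_col_isPM (hS M hM) j]
      simp [hcard.ne']
    · obtain ⟨M, hM, heM⟩ := Finset.mem_sup.1 he
      refine mul_pos (inv_pos.2 hcard) (Finset.sum_pos' (fun M _ => ?_) ⟨M, hM, ?_⟩)
      · split_ifs <;> simp
      · rw [if_pos (show e ∈ M from heM)]
        exact one_pos
    · refine mul_eq_zero_of_right _ (Finset.sum_eq_zero fun M hM => if_neg fun heM => ?_)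
      exact he (Finset.mem_sup.2 ⟨M, hM, heM⟩)
  · rintro ⟨y, hr, hc, hp, h0⟩
    have hnn := (birkhoffOpenFace_subset G ⟨hr, hc, hp, h0⟩).2.2.1
    obtain ⟨w, hw, hw1, hwy⟩ := exists_eq_sum_perm_of_mem_doublyStochastic
      (M := Matrix.of fun i j => y (i, j))
      (mem_doublyStochastic_iff_sum.2 ⟨fun i j => hnn (i, j), hr, hc⟩)
    have hy : ∀ e : Edge n, y e = ∑ σ : Equiv.Perm (Fin n), if σ e.1 = e.2 then w σ else 0 := by
      intro e
      have := congrFun (congrFun hwy e.1) e.2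
      simp only [Matrix.sum_apply, Matrix.smul_apply, Matrix.of_apply, PEquiv.toMatrix_apply,
        Equiv.Perm.permMatrix, Equiv.toPEquiv_apply, Option.mem_def, Option.some.injEq,
        smul_eq_mul, mul_ite, mul_one, mul_zero] at this
      exact this.symm
    refine ⟨(Finset.univ.filter fun σ => 0 < w σ).image
      fun σ => Finset.univ.image fun i => (i, σ i), ?_, ?_, ?_⟩
    · obtain ⟨σ, -, hσ⟩ := Finset.exists_lt_of_sum_lt (f := fun _ => (0 : ℝ)) (g := w)
        (s := Finset.univ) (by simp [hw1])
      exact ⟨_, Finset.mem_image_of_mem _ (Finset.mem_filter.2 ⟨Finset.mem_univ σ, hσ⟩)⟩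
    · intro M hM
      obtain ⟨σ, -, rfl⟩ := Finset.mem_image.1 hM
      exact ⟨σ, rfl⟩
    · ext e
      have hG : e ∈ G ↔ 0 < y e :=
        ⟨hp e, fun h => by_contra fun he => h.ne' (h0 e he)⟩
      rw [hG, hy, Finset.sum_pos_iff_of_nonneg fun σ _ => by split_ifs <;> simp [hw],
        Finset.mem_sup]
      constructor
      · rintro ⟨M, hM, heM⟩
        obtain ⟨σ, hσ, rfl⟩ := Finset.mem_image.1 hM
        exact ⟨σ, Finset.mem_univ σ, by
          rw [if_pos (mem_perm_image.1 heM)]; exact (Finset.mem_filter.1 hσ).2⟩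
      · rintro ⟨σ, -, hσ⟩
        split_ifs at hσ with h
        · exact ⟨_, Finset.mem_image_of_mem _ (Finset.mem_filter.2 ⟨Finset.mem_univ σ, hσ⟩),
            mem_perm_image.2 h⟩
        · exact absurd hσ (lt_irrefl _)

theorem birkhoffFace_nonempty_iff {H : Finset (Edge n)} :
    (birkhoffFace H).Nonempty ↔ hasPM H := by
  constructor
  · rintro ⟨y, hy⟩
    set G := Finset.univ.filter fun e => 0 < y e
    have hGH : G ⊆ H := fun e he => by
      by_contra heH
      exact (Finset.mem_filter.1 he).2.ne' (hy.2.2.2 e heH)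
    obtain ⟨S, ⟨M, hM⟩, hS, hSG⟩ := matchingCovered_iff_nonempty.2
      ⟨y, (mem_birkhoffOpenFace_iff hGH).2 ⟨hy, rfl⟩⟩
    obtain ⟨σ, rfl⟩ := hS M hM
    refine ⟨σ, fun i => hGH (hSG ▸ Finset.mem_sup.2 ⟨_, hM, ?_⟩)⟩
    exact mem_perm_image.2 rfl
  · rintro ⟨σ, hσ⟩
    obtain ⟨y, hy⟩ := matchingCovered_iff_nonempty.1
      ⟨{Finset.univ.image fun i => (i, σ i)}, by simp, fun M hM => ⟨σ, Finset.mem_singleton.1 hM⟩,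
        Finset.sup_singleton⟩
    refine ⟨y, ((mem_birkhoffOpenFace_iff fun e he => ?_).1 hy).1⟩
    have := mem_perm_image.1 he
    exact (Prod.ext rfl this : (e.1, σ e.1) = e) ▸ hσ e.1

/-- The vertex-edge incidence matrix of `G`. -/
def bipartiteIncidence (G : Finset (Edge n)) : Matrix (Fin n ⊕ Fin n) G ℝ :=
  Matrix.of fun v e => Sum.elim (fun i => if e.1.1 = i then 1 else 0)
    (fun j => if e.1.2 = j then 1 else 0) v

theorem bipartiteIncidence_mulVec_inl {G : Finset (Edge n)} {w : Edge n → ℝ}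
    (hw : ∀ e, e ∉ G → w e = 0) (i : Fin n) :
    (bipartiteIncidence G).mulVec (fun e => w e) (Sum.inl i) = ∑ j, w (i, j) := by
  simp only [Matrix.mulVec, dotProduct, bipartiteIncidence, Matrix.of_apply, Sum.elim_inl]
  rw [Finset.sum_coe_sort G fun e => (if e.1 = i then (1 : ℝ) else 0) * w e,
    Finset.sum_subset (Finset.subset_univ G) fun e _ he => by simp [hw e he],
    Fintype.sum_prod_type]
  simp

theorem bipartiteIncidence_mulVec_inr {G : Finset (Edge n)} {w : Edge n → ℝ}
    (hw : ∀ e, e ∉ G → w e = 0) (j : Fin n) :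
    (bipartiteIncidence G).mulVec (fun e => w e) (Sum.inr j) = ∑ i, w (i, j) := by
  simp only [Matrix.mulVec, dotProduct, bipartiteIncidence, Matrix.of_apply, Sum.elim_inr]
  rw [Finset.sum_coe_sort G fun e => (if e.2 = j then (1 : ℝ) else 0) * w e,
    Finset.sum_subset (Finset.subset_univ G) fun e _ he => by simp [hw e he],
    Fintype.sum_prod_type_right]
  simp

theorem finrank_flowSpace_eq_ker (G : Finset (Edge n)) :
    Module.finrank ℝ (flowSpace G) =
      Module.finrank ℝ (LinearMap.ker (bipartiteIncidence G).mulVecLin) := by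
  let R : (Edge n → ℝ) →ₗ[ℝ] (G → ℝ) := LinearMap.funLeft ℝ ℝ Subtype.val
  have hR : ∀ w ∈ flowSpace G, R w ∈ LinearMap.ker (bipartiteIncidence G).mulVecLin := by
    intro w hw
    rw [LinearMap.mem_ker]
    ext (i | j)
    · exact (bipartiteIncidence_mulVec_inl hw.2.2 i).trans (hw.1 i)
    · exact (bipartiteIncidence_mulVec_inr hw.2.2 j).trans (hw.2.1 j)
  refine (LinearEquiv.ofBijective (R.restrict hR) ⟨?_, ?_⟩).finrank_eq
  · rintro ⟨w, hw⟩ ⟨w', hw'⟩ h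
    ext e
    by_cases he : e ∈ G
    · exact congrFun (congrArg Subtype.val h) ⟨e, he⟩
    · exact (hw.2.2 e he).trans (hw'.2.2 e he).symm
  · rintro ⟨u, hu⟩
    let w : Edge n → ℝ := fun e => if he : e ∈ G then u ⟨e, he⟩ else 0
    have hw : ∀ e, e ∉ G → w e = 0 := fun e he => dif_neg he
    have hRw : (fun e : G => w e) = u := funext fun e => dif_pos e.2
    refine ⟨⟨w, fun i => ?_, fun j => ?_, hw⟩, Subtype.ext hRw⟩
    · rw [← bipartiteIncidence_mulVec_inl hw, hRw]
      exact congrFun hu _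
    · rw [← bipartiteIncidence_mulVec_inr hw, hRw]
      exact congrFun hu _

theorem mem_ker_transpose_bipartiteIncidence {G : Finset (Edge n)} {u : Fin n ⊕ Fin n → ℝ} :
    u ∈ LinearMap.ker (bipartiteIncidence G).transpose.mulVecLin ↔
      ∀ e ∈ G, u (Sum.inl e.1) + u (Sum.inr e.2) = 0 := by
  rw [LinearMap.mem_ker, funext_iff, Subtype.forall]
  refine forall₂_congr fun e he => ?_
  rw [Matrix.mulVecLin_apply, Matrix.mulVec, dotProduct, Fintype.sum_sum_type]
  simp [bipartiteIncidence]

theorem finrank_ker_transpose_bipartiteIncidence (G : Finset (Edge n)) :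
    Module.finrank ℝ (LinearMap.ker (bipartiteIncidence G).transpose.mulVecLin) =
      numComponents G := by
  rw [numComponents, Nat.card_eq_fintype_card,
    SimpleGraph.card_connectedComponent_eq_finrank_ker_toLin'_lapMatrix]
  let τ : (Fin n ⊕ Fin n → ℝ) ≃ₗ[ℝ] (Fin n ⊕ Fin n → ℝ) := LinearEquiv.piCongrRight
    (Sum.rec (fun _ => LinearEquiv.refl ℝ ℝ) fun _ => LinearEquiv.neg ℝ)
  refine (LinearEquiv.ofSubmodules τ _ _ ?_).finrank_eq
  ext u
  rw [Submodule.mem_map_equiv, mem_ker_transpose_bipartiteIncidence, LinearMap.mem_ker,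
    Matrix.toLin'_apply, SimpleGraph.lapMatrix_mulVec_eq_zero_iff_forall_adj]
  have hl : ∀ i, τ.symm u (Sum.inl i) = u (Sum.inl i) := fun _ => rfl
  have hr : ∀ j, τ.symm u (Sum.inr j) = -u (Sum.inr j) := fun _ => rfl
  simp only [hl, hr, ← sub_eq_add_neg, sub_eq_zero, graphOn, SimpleGraph.fromRel_adj]
  constructor
  · rintro h v v' ⟨-, ⟨e, he, rfl, rfl⟩ | ⟨e, he, rfl, rfl⟩⟩
    · exact h e he
    · exact (h e he).symm
  · exact fun h e he => h _ _ ⟨Sum.inl_ne_inr, Or.inl ⟨e, he, rfl, rfl⟩⟩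

theorem cyclo_eq_finrank_flowSpace (G : Finset (Edge n)) :
    cyclo G = Module.finrank ℝ (flowSpace G) := by
  have h₁ := LinearMap.finrank_range_add_finrank_ker (bipartiteIncidence G).mulVecLin
  have h₂ := LinearMap.finrank_range_add_finrank_ker (bipartiteIncidence G).transpose.mulVecLin
  have h₃ := (bipartiteIncidence G).rank_transpose
  rw [← finrank_flowSpace_eq_ker] at h₁
  rw [finrank_ker_transpose_bipartiteIncidence] at h₂
  simp only [Matrix.rank, Module.finrank_fintype_fun_eq_card, Fintype.card_coe, Fintype.card_sum,
    Fintype.card_fin] at h₁ h₂ h₃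
  rw [cyclo]
  omega

end PerfectMatchings

/-- the (unique) real multilinear polynomial representing `BPM_n` is
`BPM_n(x) = ∑_{G ∈ MC_n} (−1)^{χ(G)} ∏_{(i,j) ∈ E(G)} x_{i,j}`, the sum ranging over all
matching-covered subgraphs of `K_{n,n}`. -/
theorem stmt10 (n : ℕ) :
    ∀ x : Edge n → Bool,
      (∑ G : Finset (Edge n),
        (if matchingCovered G then (-1 : ℝ) ^ (cyclo G) else 0) *
          ∏ e ∈ G, (if x e then (1 : ℝ) else 0))
        = (if BPMb n x then 1 else 0) := by
  intro x
  set H : Finset (Edge n) := Finset.univ.filter fun e => x e = true with hH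
  have hPM : hasPM H ↔ BPMb n x := by simp [hasPM, BPMb, hH]
  have hterm : ∀ G : Finset (Edge n),
      (if matchingCovered G then (-1 : ℝ) ^ (cyclo G) else 0) *
          ∏ e ∈ G, (if x e then (1 : ℝ) else 0) =
        if G ∈ H.powerset then (((if (birkhoffOpenFace G).Nonempty
          then (-1 : ℤ) ^ Module.finrank ℝ (flowSpace G) else 0) : ℤ) : ℝ) else 0 := by
    intro G
    have hGH : G ∈ H.powerset ↔ ∀ e ∈ G, x e = true := by
      simp [hH, Finset.subset_iff]
    rw [Finset.prod_boole, ← matchingCovered_iff_nonempty, cyclo_eq_finrank_flowSpace,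
      zpow_natCast]
    simp only [hGH]
    split_ifs <;> simp
  rw [Finset.sum_congr rfl fun G _ => hterm G, Finset.sum_ite_mem, Finset.univ_inter,
    ← Int.cast_sum, sum_neg_one_pow_finrank_flowSpace, birkhoffFace_nonempty_iff, hPM]
  split_ifs <;> simp
end

section
/- The polynomial degree of BPM_n over the reals, and also over the field F_2, equals n². Consequently BPM_n is evasive: its deterministic decision-tree query complexity is exactly n². -/
open Finset
open scoped Classical

/-- Classical decision trees querying single input bits. -/
inductive DTree (E : Type) : Type where
  | leaf : Bool → DTree E
  | node : E → DTree E → DTree E → DTree E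

/-- Evaluation of a classical decision tree. -/
def DTree.eval {E : Type} : DTree E → (E → Bool) → Bool
  | .leaf b, _ => b
  | .node e t0 t1, x => if x e then DTree.eval t1 x else DTree.eval t0 x

/-- Depth of a classical decision tree. -/
def DTree.depth {E : Type} : DTree E → ℕ
  | .leaf _ => 0
  | .node _ t0 t1 => max (DTree.depth t0) (DTree.depth t1) + 1

section Parity

variable {ι κ : Type} [DecidableEq κ]

/-- A fixed-point-free involution preserving `p` shows that `p` has an even number of solutions. -/
theorem card_filter_eq_zero_of_involution {α : Type} [Fintype α] (p : α → Prop)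
    [DecidablePred p] (τ : α → α) (hτ : ∀ a, τ (τ a) = a) (hne : ∀ a, τ a ≠ a)
    (hp : ∀ a, p a → p (τ a)) :
    (#{a | p a} : ZMod 2) = 0 := by
  rw [Finset.card_eq_sum_ones, Nat.cast_sum]
  refine Finset.sum_involution (fun a _ => τ a) ?_ ?_ ?_ ?_
  · intros; decide
  · intro a _ _; exact hne a
  · intro a ha; simpa using hp a (by simpa using ha)
  · intro a _; exact hτ a

/-- `A` is the least set of rows of maximal deficiency `#A - #N(A)`. -/
def IsCritical (g : ι → Finset κ) (A : Finset ι) : Prop :=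
  ∀ X, #X + #(A.biUnion g) ≤ #A + #(X.biUnion g) ∧
    (#X + #(A.biUnion g) = #A + #(X.biUnion g) → A ⊆ X)

theorem IsCritical.eq {g : ι → Finset κ} {A B : Finset ι} (hA : IsCritical g A)
    (hB : IsCritical g B) : A = B := by
  have h1 := (hA B).1
  have h2 := (hB A).1
  exact ((hA B).2 (by omega)).antisymm ((hB A).2 (by omega))

theorem isCritical_univ_empty [Fintype ι] :
    IsCritical (fun _ : ι => (∅ : Finset κ)) Finset.univ := by
  intro X
  have h0 : ∀ Y : Finset ι, Y.biUnion (fun _ => (∅ : Finset κ)) = ∅ := by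
    intro Y; ext; simp
  rw [h0, h0]
  refine ⟨by simpa using Finset.card_le_univ X, fun h => ?_⟩
  rw [Finset.eq_univ_of_card X (by simpa using h)]

variable [DecidableEq ι]

/-- Switch the membership of `j` in the `i`-th set of the family `g`. -/
def toggle (i : ι) (j : κ) (g : ι → Finset κ) : ι → Finset κ :=
  Function.update g i (symmDiff (g i) {j})

theorem toggle_toggle (i : ι) (j : κ) (g : ι → Finset κ) : toggle i j (toggle i j g) = g := by
  simp [toggle]

theorem toggle_ne (i : ι) (j : κ) (g : ι → Finset κ) : toggle i j g ≠ g := by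
  intro h
  have := congrFun h i
  simp [toggle] at this

theorem mem_toggle (i a : ι) (j b : κ) (g : ι → Finset κ) (h : a ≠ i ∨ b ≠ j) :
    b ∈ toggle i j g a ↔ b ∈ g a := by
  by_cases ha : a = i
  · subst ha
    have hb : b ≠ j := by simpa using h
    simp [toggle, Finset.mem_symmDiff, hb]
  · simp [toggle, ha]

theorem biUnion_toggle_of_notMem (i : ι) (j : κ) (g : ι → Finset κ) (X : Finset ι) (h : i ∉ X) :
    X.biUnion (toggle i j g) = X.biUnion g := by
  ext b
  simp only [Finset.mem_biUnion]
  refine exists_congr fun a => and_congr_right fun ha => mem_toggle i a j b g (Or.inl ?_)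
  rintro rfl
  exact h ha

theorem biUnion_toggle_of_mem (i : ι) (j : κ) (g : ι → Finset κ) (X Y : Finset ι) (hi : i ∉ X)
    (hj : j ∈ X.biUnion g) (hXY : X ⊆ Y) :
    Y.biUnion (toggle i j g) = Y.biUnion g := by
  ext b
  by_cases hb : b = j
  · subst hb
    have h1 : b ∈ Y.biUnion g := Finset.biUnion_subset_biUnion_of_subset_left g hXY hj
    rw [← biUnion_toggle_of_notMem i b g X hi] at hj
    have h2 := Finset.biUnion_subset_biUnion_of_subset_left (toggle i b g) hXY hj
    simp only [h1, h2]
  · simp only [Finset.mem_biUnion]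
    exact exists_congr fun a => and_congr_right fun _ => mem_toggle i a j b g (Or.inr hb)

theorem card_biUnion_union_add_inter (g : ι → Finset κ) (X Y : Finset ι) :
    #((X ∪ Y).biUnion g) + #((X ∩ Y).biUnion g) ≤ #(X.biUnion g) + #(Y.biUnion g) := by
  rw [← Finset.card_union_add_card_inter (X.biUnion g), Finset.union_biUnion]
  gcongr
  refine Finset.subset_inter ?_ ?_
  · exact Finset.biUnion_subset_biUnion_of_subset_left g Finset.inter_subset_left
  · exact Finset.biUnion_subset_biUnion_of_subset_left g Finset.inter_subset_right

theorem IsCritical.toggle {g : ι → Finset κ} {A : Finset ι} (hA : IsCritical g A) {i : ι} {j : κ}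
    (hi : i ∉ A) (hj : j ∈ A.biUnion g) : IsCritical (toggle i j g) A := by
  intro X
  have hs := card_biUnion_union_add_inter (_root_.toggle i j g) A X
  have hc := Finset.card_union_add_card_inter A X
  rw [biUnion_toggle_of_mem i j g A (A ∪ X) hi hj Finset.subset_union_left,
    biUnion_toggle_of_notMem i j g (A ∩ X) (fun h => hi (Finset.mem_inter.mp h).1),
    biUnion_toggle_of_notMem i j g A hi] at hs
  rw [biUnion_toggle_of_notMem i j g A hi]
  have hU := (hA (A ∪ X)).1
  have hI := hA (A ∩ X)
  refine ⟨by omega, fun h => ?_⟩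
  exact (hI.2 (by omega)).trans Finset.inter_subset_right

variable [Fintype ι]

theorem exists_isCritical (g : ι → Finset κ) : ∃ A, IsCritical g A := by
  obtain ⟨A₀, -, hA₀⟩ := Finset.exists_max_image (Finset.univ : Finset (Finset ι))
    (fun A => (#A : ℤ) - #(A.biUnion g)) Finset.univ_nonempty
  obtain ⟨A, hA, hmin⟩ := Finset.exists_min_image
    {A : Finset ι | (#A : ℤ) - #(A.biUnion g) = (#A₀ : ℤ) - #(A₀.biUnion g)}
    (fun A => #A) ⟨A₀, by simp⟩
  simp only [Finset.mem_filter, Finset.mem_univ, true_and] at hA hmin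
  refine ⟨A, fun X => ?_⟩
  have hX := hA₀ X (Finset.mem_univ X)
  refine ⟨by omega, fun h => ?_⟩
  have hU := hA₀ (A ∪ X) (Finset.mem_univ _)
  have hI := hA₀ (A ∩ X) (Finset.mem_univ _)
  have hs := card_biUnion_union_add_inter g A X
  have hc := Finset.card_union_add_card_inter A X
  have := hmin (A ∩ X) (by omega)
  exact Finset.inter_eq_left.mp (Finset.eq_of_subset_of_card_le Finset.inter_subset_left this)

/-- Every nonempty set `X` of rows has at least `#X + k` neighbours. -/
def Surplus {ι κ : Type} [DecidableEq κ] (k : ℕ) (g : ι → Finset κ) : Prop :=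
  ∀ X : Finset ι, X.Nonempty → #X + k ≤ #(X.biUnion g)

/-- Every nonempty set `X` of nonempty rows has at least `#X + k` neighbours. -/
def SupportSurplus {ι κ : Type} [DecidableEq κ] (k : ℕ) (g : ι → Finset κ) : Prop :=
  ∀ X : Finset ι, X.Nonempty → (∀ i ∈ X, (g i).Nonempty) → #X + k ≤ #(X.biUnion g)

/-- The transposed family. -/
def transposeFamily (g : ι → Finset κ) : κ → Finset ι := fun j => {i | j ∈ g i}

theorem transposeFamily_transposeFamily [Fintype κ] (g : ι → Finset κ) :
    transposeFamily (transposeFamily g) = g := by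
  ext i j; simp [transposeFamily]

theorem supportSurplus_zero_iff (g : ι → Finset κ) :
    SupportSurplus 0 g ↔ ∃ A, IsCritical g A ∧ A.biUnion g = ∅ := by
  constructor
  · intro h
    have h0 : Finset.biUnion {i | g i = ∅} g = ∅ := by
      ext j; simp +contextual
    refine ⟨({i | g i = ∅} : Finset ι), fun X => ?_, h0⟩
    rw [h0]
    have hX := Finset.card_filter_add_card_filter_not (s := X) (fun i => g i = ∅)
    have h1 : #(X.filter fun i => ¬ g i = ∅) ≤ #(X.biUnion g) := by
      rcases (X.filter fun i => ¬ g i = ∅).eq_empty_or_nonempty with he | he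
      · simp [he]
      · refine (h _ he (fun i hi => ?_)).trans (Finset.card_le_card ?_)
        · exact Finset.nonempty_iff_ne_empty.mpr (Finset.mem_filter.mp hi).2
        · exact Finset.biUnion_subset_biUnion_of_subset_left g (Finset.filter_subset _ _)
    have h2 : X.filter (fun i => g i = ∅) ⊆ ({i | g i = ∅} : Finset ι) :=
      Finset.filter_subset_filter _ (Finset.subset_univ X)
    have h3 := Finset.card_le_card h2
    rw [Finset.card_empty]
    refine ⟨by omega, fun he => ?_⟩
    rw [← Finset.eq_of_subset_of_card_le h2 (by omega)]
    exact Finset.filter_subset _ _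
  · rintro ⟨A, hA, h0⟩ X - hX
    have hd : Disjoint X A := by
      rw [Finset.disjoint_left]
      intro i hi hiA
      obtain ⟨j, hj⟩ := hX i hi
      have : j ∈ A.biUnion g := Finset.mem_biUnion.mpr ⟨i, hiA, hj⟩
      simp [h0] at this
    have := (hA (X ∪ A)).1
    rw [Finset.card_union_of_disjoint hd, Finset.union_biUnion, h0] at this
    simp at this
    omega

theorem supportSurplus_one_transpose_iff (g : ι → Finset κ) :
    SupportSurplus 1 (transposeFamily g) ↔ IsCritical g Finset.univ := by
  constructor
  · intro h X
    by_cases hX : X = Finset.univ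
    · subst hX; simp
    have hlt : #X < #(Finset.univ : Finset ι) :=
      Finset.card_lt_card (Finset.ssubset_univ_iff.mpr hX)
    suffices #X + #(Finset.univ.biUnion g) < #(Finset.univ : Finset ι) + #(X.biUnion g) from
      ⟨this.le, fun h => absurd h this.ne⟩
    have hsub : X.biUnion g ⊆ Finset.univ.biUnion g :=
      Finset.biUnion_subset_biUnion_of_subset_left g (Finset.subset_univ X)
    have hc := Finset.card_sdiff_add_card_eq_card hsub
    rcases (Finset.univ.biUnion g \ X.biUnion g).eq_empty_or_nonempty with he | he
    · rw [he, Finset.card_empty] at hc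
      omega
    · have h1 := h _ he (fun j hj => by
        obtain ⟨i, -, hi⟩ := Finset.mem_biUnion.mp (Finset.mem_sdiff.mp hj).1
        exact ⟨i, by simpa [transposeFamily] using hi⟩)
      have h2 : (Finset.univ.biUnion g \ X.biUnion g).biUnion (transposeFamily g) ⊆ Xᶜ := by
        intro i hi
        simp only [transposeFamily, Finset.mem_biUnion, Finset.mem_sdiff, Finset.mem_filter,
          Finset.mem_univ, true_and, Finset.mem_compl] at hi ⊢
        obtain ⟨j, ⟨-, hj⟩, hij⟩ := hi
        exact fun hiX => hj ⟨i, hiX, hij⟩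
      have h3 := Finset.card_le_card h2
      rw [Finset.card_compl] at h3
      rw [Finset.card_univ] at *
      omega
  · intro h Y hY hne
    obtain ⟨j, hj⟩ := hY
    obtain ⟨i, hi⟩ := hne j hj
    have hmem : i ∈ Y.biUnion (transposeFamily g) := Finset.mem_biUnion.mpr ⟨j, hj, hi⟩
    have hX := h (Y.biUnion (transposeFamily g))ᶜ
    have hnu : ¬ (Finset.univ : Finset ι) ⊆ (Y.biUnion (transposeFamily g))ᶜ := by
      intro hs
      exact Finset.mem_compl.mp (hs (Finset.mem_univ i)) hmem
    have hlt := lt_of_le_of_ne hX.1 (fun he => hnu (hX.2 he))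
    have h1 : (Y.biUnion (transposeFamily g))ᶜ.biUnion g ⊆ Finset.univ.biUnion g \ Y := by
      intro b hb
      obtain ⟨a, ha, hab⟩ := Finset.mem_biUnion.mp hb
      refine Finset.mem_sdiff.mpr ⟨Finset.mem_biUnion.mpr ⟨a, Finset.mem_univ a, hab⟩, fun hbY => ?_⟩
      exact Finset.mem_compl.mp ha
        (Finset.mem_biUnion.mpr ⟨b, hbY, by simpa [transposeFamily] using hab⟩)
    have h2 : Y ⊆ Finset.univ.biUnion g := by
      intro b hb
      obtain ⟨a, ha⟩ := hne b hb
      exact Finset.mem_biUnion.mpr ⟨a, Finset.mem_univ a, by simpa [transposeFamily] using ha⟩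
    have h3 := Finset.card_le_card h1
    have h4 := Finset.card_sdiff_add_card_eq_card h2
    have h5 := Finset.card_le_univ (Y.biUnion (transposeFamily g))
    rw [Finset.card_compl, Finset.card_univ] at hlt
    omega

/-- Number modulo 2 of families of subsets of `κ` indexed by `ι` with surplus `k`. -/
noncomputable def surplusParity (k : ℕ) (ι κ : Type) [Fintype ι] [Fintype κ] [DecidableEq ι]
    [DecidableEq κ] : ZMod 2 :=
  (#{g : ι → Finset κ | Surplus k g} : ZMod 2)

/-- Number modulo 2 of families whose nonempty members have surplus `k`. -/
noncomputable def supportSurplusParity (k : ℕ) (ι κ : Type) [Fintype ι] [Fintype κ]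
    [DecidableEq ι] [DecidableEq κ] : ZMod 2 :=
  (#{g : ι → Finset κ | SupportSurplus k g} : ZMod 2)

theorem supportSurplusParity_add [Fintype κ] [Nonempty ι] [Nonempty κ] :
    supportSurplusParity 0 ι κ + supportSurplusParity 1 κ ι = 1 := by
  let c : (ι → Finset κ) → Finset ι := fun g => (exists_isCritical g).choose
  have hc : ∀ g, IsCritical g (c g) := fun g => (exists_isCritical g).choose_spec
  let N : (ι → Finset κ) → Finset κ := fun g => (c g).biUnion g
  have hp : ∀ g, SupportSurplus 0 g ↔ N g = ∅ := fun g => by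
    rw [supportSurplus_zero_iff]
    constructor
    · rintro ⟨A, hA, h0⟩
      rw [(hc g).eq hA |>.symm] at h0
      exact h0
    · exact fun h => ⟨c g, hc g, h⟩
  have hq : ∀ g, SupportSurplus 1 (transposeFamily g) ↔ c g = Finset.univ := fun g => by
    rw [supportSurplus_one_transpose_iff]
    exact ⟨fun h => (hc g).eq h, fun h => h ▸ hc g⟩
  have hbad : (#{g | N g ≠ ∅ ∧ c g ≠ Finset.univ} : ZMod 2) = 0 := by
    let cell : Finset ι × Finset κ → ι × κ := fun P =>
      if h : P.2 ≠ ∅ ∧ P.1 ≠ Finset.univ then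
        (((Finset.ssubset_univ_iff.mpr h.2) |> Finset.exists_of_ssubset).choose,
          (Finset.nonempty_iff_ne_empty.mpr h.1).choose)
      else (Classical.arbitrary ι, Classical.arbitrary κ)
    have hcell : ∀ P : Finset ι × Finset κ, P.2 ≠ ∅ ∧ P.1 ≠ Finset.univ →
        (cell P).1 ∉ P.1 ∧ (cell P).2 ∈ P.2 := by
      intro P h
      simp only [cell, dif_pos h]
      exact ⟨((Finset.ssubset_univ_iff.mpr h.2) |> Finset.exists_of_ssubset).choose_spec.2,
        (Finset.nonempty_iff_ne_empty.mpr h.1).choose_spec⟩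
    have hpair : ∀ P : Finset ι × Finset κ, P.2 ≠ ∅ ∧ P.1 ≠ Finset.univ →
        (#{g | (c g, N g) = P} : ZMod 2) = 0 := by
      intro P h
      refine card_filter_eq_zero_of_involution _ (toggle (cell P).1 (cell P).2)
        (toggle_toggle _ _) (toggle_ne _ _) ?_
      rintro g rfl
      obtain ⟨hi, hj⟩ := hcell _ h
      have h1 := (hc _).eq ((hc g).toggle hi hj)
      refine Prod.ext h1 ?_
      simp only [N, h1]
      exact biUnion_toggle_of_notMem _ _ _ _ hi
    rw [Finset.card_eq_sum_card_fiberwise (f := fun g => (c g, N g))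
      (t := {P | P.2 ≠ ∅ ∧ P.1 ≠ Finset.univ}) (by intro g hg; simpa using hg), Nat.cast_sum]
    refine Finset.sum_eq_zero fun P hP => ?_
    have hP' : P.2 ≠ ∅ ∧ P.1 ≠ Finset.univ := by simpa using hP
    rw [← hpair P hP', Finset.filter_filter]
    congr 3
    ext g
    constructor
    · exact fun h => h.2
    · rintro rfl; exact ⟨hP', rfl⟩
  have hq' : supportSurplusParity 1 κ ι = (#{g | c g = Finset.univ} : ZMod 2) := by
    unfold supportSurplusParity
    congr 1
    refine Finset.card_nbij' transposeFamily transposeFamily ?_ ?_ ?_ ?_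
    · intro g hg
      have : SupportSurplus 1 g := by simpa using hg
      rw [← transposeFamily_transposeFamily g, hq] at this
      simpa using this
    · intro g hg
      have : c g = Finset.univ := by simpa using hg
      simpa using (hq g).mpr this
    · intro g _; exact transposeFamily_transposeFamily g
    · intro g _; exact transposeFamily_transposeFamily g
  have hp' : supportSurplusParity 0 ι κ = (#{g | N g = ∅} : ZMod 2) := by
    unfold supportSurplusParity
    simp only [hp]
  have hboth : #{g | N g = ∅ ∧ c g = Finset.univ} = 1 := by
    rw [Finset.card_eq_one]
    refine ⟨fun _ => ∅, ?_⟩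
    ext g
    simp only [Finset.mem_filter, Finset.mem_univ, true_and, Finset.mem_singleton]
    constructor
    · rintro ⟨h1, h2⟩
      simp only [N, h2] at h1
      funext i
      exact Finset.subset_empty.mp (h1 ▸ Finset.subset_biUnion_of_mem g (Finset.mem_univ i))
    · rintro rfl
      refine ⟨?_, (hc _).eq isCritical_univ_empty⟩
      ext; simp [N]
  have htot : (#{g : ι → Finset κ | True} : ZMod 2) = 0 :=
    card_filter_eq_zero_of_involution _ (toggle (Classical.arbitrary ι) (Classical.arbitrary κ))
      (toggle_toggle _ _) (toggle_ne _ _) (fun _ _ => trivial)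
  rw [hp', hq']
  simp only [Finset.natCast_card_filter] at *
  have hboth' : (∑ g, if N g = ∅ ∧ c g = Finset.univ then (1 : ZMod 2) else 0) = 1 := by
    rw [← Finset.natCast_card_filter, hboth, Nat.cast_one]
  calc _ = (∑ g, if True then (1 : ZMod 2) else 0)
        + (∑ g, if N g ≠ ∅ ∧ c g ≠ Finset.univ then (1 : ZMod 2) else 0)
        + ∑ g, if N g = ∅ ∧ c g = Finset.univ then (1 : ZMod 2) else 0 := by
        rw [← Finset.sum_add_distrib, ← Finset.sum_add_distrib, ← Finset.sum_add_distrib]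
        refine Finset.sum_congr rfl fun g _ => ?_
        by_cases h1 : N g = ∅ <;> by_cases h2 : c g = Finset.univ <;> simp [h1, h2]; decide
    _ = 1 := by rw [htot, hbad, hboth']; simp

end Parity

section Counting

theorem biUnion_map_left {α β γ : Type} [DecidableEq γ] (f : α ↪ β) (X : Finset α)
    (g : β → Finset γ) : (X.map f).biUnion g = X.biUnion fun a => g (f a) := by
  ext; simp

theorem Surplus.congr {ι κ ι' κ' : Type} [DecidableEq κ] [DecidableEq κ'] {k : ℕ}
    {g : ι → Finset κ} (hg : Surplus k g) (e : ι ≃ ι') (f : κ ≃ κ') :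
    Surplus k (fun i => (g (e.symm i)).map f.toEmbedding) := by
  intro X hX
  have h := hg (X.map e.symm.toEmbedding) (hX.map)
  have he : X.biUnion (fun i => (g (e.symm i)).map f.toEmbedding)
      = ((X.map e.symm.toEmbedding).biUnion g).map f.toEmbedding := by
    ext j
    simp only [Finset.mem_biUnion, Finset.mem_map, Equiv.coe_toEmbedding]
    constructor
    · rintro ⟨i, hi, b, hb, rfl⟩
      exact ⟨b, ⟨_, ⟨i, hi, rfl⟩, hb⟩, rfl⟩
    · rintro ⟨b, ⟨_, ⟨i, hi, rfl⟩, hb⟩, rfl⟩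
      exact ⟨i, hi, b, hb, rfl⟩
  rw [he, Finset.card_map]
  rwa [Finset.card_map] at h

theorem surplusParity_congr {ι κ ι' κ' : Type} [Fintype ι] [Fintype κ] [DecidableEq ι]
    [DecidableEq κ] [Fintype ι'] [Fintype κ'] [DecidableEq ι'] [DecidableEq κ'] (k : ℕ)
    (e : ι ≃ ι') (f : κ ≃ κ') : surplusParity k ι κ = surplusParity k ι' κ' := by
  unfold surplusParity
  congr 1
  refine Finset.card_nbij' (fun g i => (g (e.symm i)).map f.toEmbedding)
    (fun g i => (g (e i)).map f.symm.toEmbedding) ?_ ?_ ?_ ?_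
  · intro g hg
    have hg' : Surplus k g := by simpa using hg
    simpa using hg'.congr e f
  · intro g hg
    have hg' : Surplus k g := by simpa using hg
    simpa using hg'.congr e.symm f.symm
  · intro g _
    funext i
    ext j
    simp
  · intro g _
    funext i
    ext j
    simp

theorem supportSurplusParity_eq_sum_powerset {ι κ : Type} [Fintype ι] [Fintype κ] [DecidableEq ι]
    [DecidableEq κ] (k : ℕ) :
    supportSurplusParity k ι κ = ∑ E : Finset ι, surplusParity k E κ := by
  unfold supportSurplusParity
  rw [Finset.card_eq_sum_card_fiberwise (f := fun g => ({i | (g i).Nonempty} : Finset ι))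
    (t := Finset.univ) (by intro g _; simp), Nat.cast_sum]
  refine Finset.sum_congr rfl fun E _ => ?_
  unfold surplusParity
  congr 1
  rw [Finset.filter_filter]
  refine Finset.card_nbij' (fun g i => g i.1)
    (fun h i => if hi : i ∈ E then h ⟨i, hi⟩ else ∅) ?_ ?_ ?_ ?_
  · intro g hg
    simp only [Finset.coe_filter, Finset.mem_univ, true_and, Set.mem_ofPred_eq] at hg ⊢
    obtain ⟨hg, rfl⟩ := hg
    intro X hX
    have h := hg (X.map (Function.Embedding.subtype _)) hX.map (by
      intro i hi
      obtain ⟨a, -, rfl⟩ := Finset.mem_map.mp hi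
      simpa using (Finset.mem_filter.mp a.2).2)
    rwa [Finset.card_map, biUnion_map_left] at h
  · intro h hh
    simp only [Finset.coe_filter, Finset.mem_univ, true_and, Set.mem_ofPred_eq] at hh ⊢
    have hne : ∀ a, (h a).Nonempty := by
      intro a
      have := hh {a} (Finset.singleton_nonempty a)
      rw [Finset.singleton_biUnion, Finset.card_singleton] at this
      exact Finset.card_pos.mp (by omega)
    have hsupp : ∀ i, (if hi : i ∈ E then h ⟨i, hi⟩ else ∅).Nonempty ↔ i ∈ E := by
      intro i
      by_cases hi : i ∈ E
      · simp [hi, hne]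
      · simp [hi]
    refine ⟨?_, by ext i; simp only [Finset.mem_filter, Finset.mem_univ, true_and, hsupp]⟩
    intro X hX hXne
    have hXE : ∀ i ∈ X, i ∈ E := fun i hi => (hsupp i).mp (hXne i hi)
    have hmap : (X.subtype (· ∈ E)).map (Function.Embedding.subtype _) = X :=
      Finset.subtype_map_of_mem hXE
    have hX' : (X.subtype (· ∈ E)).Nonempty := by
      rw [← Finset.map_nonempty (f := Function.Embedding.subtype _), hmap]; exact hX
    have := hh _ hX'
    rw [← hmap, Finset.card_map, biUnion_map_left]
    simpa using this
  · intro g hg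
    simp only [Finset.coe_filter, Finset.mem_univ, true_and, Set.mem_ofPred_eq] at hg
    obtain ⟨-, rfl⟩ := hg
    funext i
    by_cases hi : (g i).Nonempty
    · simp [hi]
    · simp [Finset.not_nonempty_iff_eq_empty.mp hi]
  · intro h _
    funext i
    simp

theorem supportSurplusParity_eq_sum_range (k m n : ℕ) :
    supportSurplusParity k (Fin m) (Fin n)
      = ∑ a ∈ Finset.range (m + 1), (m.choose a : ZMod 2) * surplusParity k (Fin a) (Fin n) := by
  rw [supportSurplusParity_eq_sum_powerset]
  have h : ∀ E : Finset (Fin m), surplusParity k E (Fin n)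
      = (fun a => surplusParity k (Fin a) (Fin n)) #E := fun E =>
    surplusParity_congr k (Fintype.equivFinOfCardEq (by simp)) (Equiv.refl _)
  rw [Finset.sum_congr rfl fun E _ => h E, ← Finset.powerset_univ,
    Finset.sum_powerset_apply_card (fun a => surplusParity k (Fin a) (Fin n))]
  simp

theorem surplus_zero_option_iff {ι κ : Type} [DecidableEq ι] [DecidableEq κ] (N : Finset κ)
    (g : ι → Finset κ) :
    Surplus 0 (fun o : Option ι => o.elim N g) ↔
      Surplus 0 g ∧ ∀ Y : Finset ι, #Y + 1 ≤ #(N ∪ Y.biUnion g) := by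
  have hsome : ∀ Y : Finset ι, (Y.map Function.Embedding.some).biUnion
      (fun o : Option ι => o.elim N g) = Y.biUnion g := by
    intro Y; ext j; simp
  have hnone : ∀ Y : Finset ι, Y.insertNone.biUnion (fun o : Option ι => o.elim N g)
      = N ∪ Y.biUnion g := by
    intro Y
    ext j
    simp only [Finset.mem_biUnion, Finset.mem_union, Option.exists, Option.elim]
    simp
  constructor
  · intro h
    refine ⟨fun X hX => ?_, fun Y => ?_⟩
    · have := h _ (hX.map (f := Function.Embedding.some))
      rwa [hsome, Finset.card_map] at this
    · have := h Y.insertNone ⟨none, by simp⟩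
      rwa [hnone, Finset.card_insertNone] at this
  · rintro ⟨h0, h1⟩ X hX
    by_cases hn : none ∈ X
    · have he : X = X.eraseNone.insertNone := by
        rw [Finset.insertNone_eraseNone, Finset.insert_eq_of_mem hn]
      rw [he, hnone, Finset.card_insertNone]
      exact h1 _
    · have he : X = X.eraseNone.map Function.Embedding.some := by
        rw [Finset.map_some_eraseNone, Finset.erase_eq_of_notMem hn]
      have hne : X.eraseNone.Nonempty := by
        rw [he] at hX; exact Finset.map_nonempty.mp hX
      rw [he, hsome, Finset.card_map]
      exact h0 _ hne

theorem card_surplus_zero_option {ι κ : Type} [Fintype κ] [DecidableEq ι] [DecidableEq κ]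
    [Nonempty κ] (g : ι → Finset κ) :
    (#{N : Finset κ | Surplus 0 (fun o : Option ι => o.elim N g)} : ZMod 2)
      = if Surplus 1 g then 1 else 0 := by
  simp only [surplus_zero_option_iff]
  split_ifs with hg
  · have he : ({N : Finset κ | Surplus 0 g ∧ ∀ Y : Finset ι, #Y + 1 ≤ #(N ∪ Y.biUnion g)}
        : Finset (Finset κ)) = Finset.univ.erase ∅ := by
      ext N
      simp only [Finset.mem_filter, Finset.mem_univ, true_and, Finset.mem_erase, and_true]
      constructor
      · rintro ⟨-, h⟩ rfl
        simpa using h ∅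
      · intro hN
        refine ⟨fun X hX => (hg X hX).trans' (by omega), fun Y => ?_⟩
        rcases Y.eq_empty_or_nonempty with rfl | hY
        · simpa [Finset.card_pos, Finset.nonempty_iff_ne_empty, Nat.one_le_iff_ne_zero] using hN
        · exact (hg Y hY).trans (Finset.card_le_card Finset.subset_union_right)
    rw [he, Finset.card_erase_of_mem (Finset.mem_univ _), Finset.card_univ, Fintype.card_finset,
      Nat.cast_sub Nat.one_le_two_pow, Nat.cast_pow]
    have : (2 : ZMod 2) = 0 := by decide
    simp [this]
  · simp only [Surplus, not_forall, not_le] at hg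
    obtain ⟨X, hX, hlt⟩ := hg
    by_cases h0 : Surplus 0 g
    · have hXc := h0 X hX
      have hpos := Finset.card_pos.mpr hX
      obtain ⟨j, hj⟩ := Finset.card_pos.mp (show 0 < #(X.biUnion g) by omega)
      refine card_filter_eq_zero_of_involution _ (fun N => symmDiff N {j}) ?_ ?_ ?_
      · intro N; simp
      · intro N; simp
      · rintro N ⟨-, h⟩
        refine ⟨h0, fun Y => ?_⟩
        have hU := h (Y ∪ X)
        have hjU : j ∈ (Y ∪ X).biUnion g :=
          Finset.biUnion_subset_biUnion_of_subset_left g Finset.subset_union_right hj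
        have he : symmDiff N {j} ∪ (Y ∪ X).biUnion g = N ∪ (Y ∪ X).biUnion g := by
          ext b
          by_cases hb : b = j
          · subst hb; simp only [Finset.mem_union, hjU, or_true]
          · simp [Finset.mem_symmDiff, hb]
        rw [← he] at hU
        have hI : #(Y ∩ X) ≤ #((Y ∩ X).biUnion g) := by
          rcases (Y ∩ X).eq_empty_or_nonempty with h | h
          · simp [h]
          · exact h0 _ h
        have h1 := Finset.card_union_add_card_inter Y X
        have h2 := Finset.card_union_add_card_inter (symmDiff N {j} ∪ Y.biUnion g) (X.biUnion g)
        rw [Finset.union_assoc, ← Finset.union_biUnion] at h2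
        have h3 : #((Y ∩ X).biUnion g)
            ≤ #((symmDiff N {j} ∪ Y.biUnion g) ∩ X.biUnion g) := by
          refine Finset.card_le_card (Finset.subset_inter ?_ ?_)
          · exact (Finset.biUnion_subset_biUnion_of_subset_left g Finset.inter_subset_left).trans
              Finset.subset_union_right
          · exact Finset.biUnion_subset_biUnion_of_subset_left g Finset.inter_subset_right
        omega
    · simp [h0]

theorem surplusParity_option {ι κ : Type} [Fintype ι] [Fintype κ] [DecidableEq ι] [DecidableEq κ]
    [Nonempty κ] : surplusParity 0 (Option ι) κ = surplusParity 1 ι κ := by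
  unfold surplusParity
  rw [Finset.natCast_card_filter, Finset.natCast_card_filter]
  have hsymm : ∀ p : Finset κ × (ι → Finset κ),
      (Equiv.piOptionEquivProd (β := fun _ : Option ι => Finset κ)).symm p
        = fun o => o.elim p.1 p.2 := by
    intro p; funext o; cases o <;> rfl
  rw [← Equiv.sum_comp (Equiv.piOptionEquivProd (β := fun _ : Option ι => Finset κ)).symm,
    Fintype.sum_prod_type_right]
  refine Finset.sum_congr rfl fun g _ => ?_
  rw [← card_surplus_zero_option g, Finset.natCast_card_filter]
  refine Finset.sum_congr rfl fun N _ => ?_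
  simp only [hsymm]

theorem surplusParity_of_isEmpty {ι κ : Type} [Fintype ι] [Fintype κ] [DecidableEq ι]
    [DecidableEq κ] [IsEmpty ι] (k : ℕ) : surplusParity k ι κ = 1 := by
  unfold surplusParity
  rw [Finset.filter_true_of_mem]
  · simp
  · rintro g - X ⟨i, -⟩
    exact isEmptyElim i

theorem surplusParity_one_eq_zero (b n : ℕ) (hb : 0 < b) (h : n ≤ b) :
    surplusParity 1 (Fin b) (Fin n) = 0 := by
  unfold surplusParity
  rw [Finset.filter_false_of_mem, Finset.card_empty, Nat.cast_zero]
  intro g _ hg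
  have : Nonempty (Fin b) := ⟨⟨0, hb⟩⟩
  have h1 := hg Finset.univ Finset.univ_nonempty
  have h2 := Finset.card_le_univ (Finset.univ.biUnion g)
  rw [Finset.card_univ, Fintype.card_fin] at h1
  rw [Fintype.card_fin] at h2
  omega

theorem surplusParity_relation (m n : ℕ) (hm : 0 < m) (hn : 0 < n) :
    (∑ a ∈ Finset.range m, (m.choose (a + 1) : ZMod 2) * surplusParity 1 (Fin a) (Fin n))
      + ∑ b ∈ Finset.range (n + 1), (n.choose b : ZMod 2) * surplusParity 1 (Fin b) (Fin m)
      = 0 := by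
  have : Nonempty (Fin m) := ⟨⟨0, hm⟩⟩
  have : Nonempty (Fin n) := ⟨⟨0, hn⟩⟩
  have h := supportSurplusParity_add (ι := Fin m) (κ := Fin n)
  rw [supportSurplusParity_eq_sum_range, supportSurplusParity_eq_sum_range,
    Finset.sum_range_succ'] at h
  have h0 : ∀ a, surplusParity 0 (Fin (a + 1)) (Fin n) = surplusParity 1 (Fin a) (Fin n) :=
    fun a => by
      rw [← surplusParity_option]
      exact surplusParity_congr 0 (finSuccEquiv a) (Equiv.refl _)
  simp only [h0, surplusParity_of_isEmpty (ι := Fin 0), Nat.choose_zero_right, Nat.cast_one,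
    mul_one] at h
  linear_combination h

theorem sum_choose_mul_choose (x y M : ℕ) :
    ∑ b ∈ Finset.range (M + 1), x.choose (M - b) * y.choose b = (x + y).choose M := by
  rw [add_comm x y, Nat.add_choose_eq, Finset.Nat.sum_antidiagonal_eq_sum_range_succ_mk]
  exact Finset.sum_congr rfl fun _ _ => mul_comm _ _

theorem choose_relation (m n : ℕ) (hm : 0 < m) (hn : 0 < n) :
    ∑ a ∈ Finset.range m, m.choose (a + 1) * (n - 1).choose a
      = ∑ b ∈ Finset.range (n + 1), n.choose b * (m - 1).choose b := by
  obtain ⟨M, rfl⟩ := Nat.exists_eq_succ_of_ne_zero hm.ne'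
  obtain ⟨N, rfl⟩ := Nat.exists_eq_succ_of_ne_zero hn.ne'
  simp only [Nat.succ_eq_add_one, Nat.add_sub_cancel]
  have h1 := sum_choose_mul_choose (M + 1) N M
  have h2 := sum_choose_mul_choose (N + 1) M (N + 1)
  have h3 : (M + 1 + N).choose M = (N + 1 + M).choose (N + 1) := by
    rw [Nat.choose_symm_of_eq_add (show M + 1 + N = M + (N + 1) by omega)]
    congr 1
    omega
  rw [← h1, ← h2] at h3
  convert h3 using 2 with a ha b hb
  · rw [Nat.choose_symm_of_eq_add]
    have := Finset.mem_range.mp ha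
    omega
  · rw [Nat.choose_symm_of_eq_add]
    have := Finset.mem_range.mp hb
    omega

theorem eq_zero_of_relation (q : ℕ → ℕ → ZMod 2)
    (h0 : ∀ n, 0 < n → q 0 n = 0) (hge : ∀ b n, 0 < b → n ≤ b → q b n = 0)
    (hrel : ∀ m n, 0 < m → 0 < n → (∑ a ∈ Finset.range m, (m.choose (a + 1) : ZMod 2) * q a n)
      + ∑ b ∈ Finset.range (n + 1), (n.choose b : ZMod 2) * q b m = 0) (n : ℕ) :
    0 < n → ∀ b, q b n = 0 := by
  induction n using Nat.strong_induction_on with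
  | _ n ihn =>
    intro hn
    have hlt : ∀ b, b + 1 < n → q b n = 0 := by
      intro b
      induction b using Nat.strong_induction_on with
      | _ b ihb =>
        intro hb
        have h := hrel (b + 1) n (by omega) hn
        rw [Finset.sum_range_succ, Finset.sum_eq_zero, Finset.sum_eq_zero] at h
        · simpa using h
        · intro b' _
          rw [ihn (b + 1) hb (by omega), mul_zero]
        · intro a ha
          have := Finset.mem_range.mp ha
          rw [ihb a this (by omega), mul_zero]
    intro b
    rcases lt_trichotomy (b + 1) n with h | h | h
    · exact hlt b h
    · rcases Nat.eq_zero_or_pos b with rfl | hb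
      · exact h0 n hn
      · have h' := hrel n b hn hb
        rw [Finset.sum_range_succ (n := b), Finset.sum_eq_zero, Finset.sum_eq_zero] at h'
        · simpa using h'
        · intro b' hb'
          have := Finset.mem_range.mp hb'
          rw [hlt b' (by omega), mul_zero]
        · intro a _
          rw [ihn b (by omega) hb, mul_zero]
    · rcases Nat.eq_zero_or_pos b with rfl | hb
      · exact h0 n hn
      · exact hge b n hb (by omega)

theorem surplusParity_one_fin (b n : ℕ) (hn : 0 < n) :
    surplusParity 1 (Fin b) (Fin n) = ((n - 1).choose b : ZMod 2) := by
  have h2 : (1 : ZMod 2) + 1 = 0 := by decide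
  have h := eq_zero_of_relation
    (fun b n => surplusParity 1 (Fin b) (Fin n) + ((n - 1).choose b : ZMod 2)) ?_ ?_ ?_ n hn b
  · rwa [CharTwo.add_eq_zero] at h
  · intro n _
    simp [surplusParity_of_isEmpty, h2]
  · intro b n hb hle
    rw [surplusParity_one_eq_zero b n hb hle, Nat.choose_eq_zero_of_lt (by omega)]
    simp
  · intro m n hm hn
    have h := surplusParity_relation m n hm hn
    have hc := congrArg (Nat.cast : ℕ → ZMod 2) (choose_relation m n hm hn)
    push_cast at hc
    simp only [mul_add, Finset.sum_add_distrib]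
    rw [hc]
    linear_combination h + (∑ b ∈ Finset.range (n + 1),
      (n.choose b : ZMod 2) * ((m - 1).choose b : ZMod 2)) * h2

theorem surplusParity_zero_fin (n : ℕ) : surplusParity 0 (Fin n) (Fin n) = 1 := by
  rcases n with _ | n
  · exact surplusParity_of_isEmpty 0
  · rw [surplusParity_congr 0 (finSuccEquiv n) (Equiv.refl (Fin (n + 1))), surplusParity_option,
      surplusParity_one_fin n (n + 1) n.succ_pos]
    simp

theorem card_BPMb (n : ℕ) : (#{x : Edge n → Bool | BPMb n x} : ZMod 2) = 1 := by
  rw [← surplusParity_zero_fin n]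
  unfold surplusParity
  congr 1
  have hall : ∀ g : Fin n → Finset (Fin n), Surplus 0 g ↔
      ∃ σ : Equiv.Perm (Fin n), ∀ i, σ i ∈ g i := by
    intro g
    have : Surplus 0 g ↔ ∀ s : Finset (Fin n), #s ≤ #(s.biUnion g) := by
      refine ⟨fun h s => ?_, fun h s _ => h s⟩
      rcases s.eq_empty_or_nonempty with rfl | hs
      · simp
      · exact h s hs
    rw [this, Finset.all_card_le_biUnion_card_iff_exists_injective]
    constructor
    · rintro ⟨f, hf, hfg⟩
      exact ⟨Equiv.ofBijective f (Finite.injective_iff_bijective.mp hf), hfg⟩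
    · rintro ⟨σ, hσ⟩
      exact ⟨σ, σ.injective, hσ⟩
  refine Finset.card_nbij' (fun x i => {j | x (i, j) = true}) (fun g e => decide (e.2 ∈ g e.1))
    ?_ ?_ ?_ ?_
  · intro x hx
    have hx' : BPMb n x := by simpa using hx
    obtain ⟨σ, hσ⟩ := hx'
    simp only [Finset.coe_filter, Finset.mem_univ, true_and, Set.mem_ofPred_eq, hall]
    exact ⟨σ, fun i => by simpa using hσ i⟩
  · intro g hg
    have hg' : Surplus 0 g := by simpa using hg
    obtain ⟨σ, hσ⟩ := (hall g).mp hg'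
    simp only [Finset.coe_filter, Finset.mem_univ, true_and, Set.mem_ofPred_eq]
    exact ⟨σ, fun i => by simpa using hσ i⟩
  · intro x _
    funext e
    simp
  · intro g _
    funext i
    ext j
    simp

end Counting

section DecisionTree

variable {E : Type} [DecidableEq E]

theorem DTree.exists_eval_eq (Q : Finset E) : ∀ f : (E → Bool) → Bool,
    (∀ x y, (∀ e ∈ Q, x e = y e) → f x = f y) →
    ∃ T : DTree E, (∀ x, T.eval x = f x) ∧ T.depth ≤ #Q := by
  induction Q using Finset.induction_on with
  | empty =>
    intro f hf
    exact ⟨.leaf (f fun _ => false), fun x => hf _ _ (by simp), by simp [DTree.depth]⟩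
  | insert e Q he ih =>
    intro f hf
    have h : ∀ b, ∃ T : DTree E, (∀ x, T.eval x = f (Function.update x e b)) ∧ T.depth ≤ #Q := by
      intro b
      refine ih (fun x => f (Function.update x e b)) fun x y hxy => hf _ _ fun a ha => ?_
      by_cases hae : a = e
      · subst hae; simp
      · simpa [hae] using hxy a (Finset.mem_of_mem_insert_of_ne ha hae)
    obtain ⟨t0, h0, hd0⟩ := h false
    obtain ⟨t1, h1, hd1⟩ := h true
    refine ⟨.node e t0 t1, fun x => ?_, ?_⟩
    · rw [DTree.eval, h0, h1]
      cases hx : x e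
      · rw [← hx, Function.update_eq_self, hx]; simp
      · rw [← hx, Function.update_eq_self, hx]; simp
    · rw [DTree.depth, Finset.card_insert_of_notMem he]
      omega

variable [Fintype E]

theorem DTree.card_filter_eq_zero (T : DTree E) : ∀ (Q : Finset E) (p : (E → Bool) → Prop),
    (∀ x y, (∀ e ∈ Q, x e = y e) → p x → p y) → #Q + T.depth < Fintype.card E →
    (#{x | p x ∧ T.eval x = true} : ZMod 2) = 0 := by
  induction T with
  | leaf b =>
    intro Q p hp hlt
    obtain ⟨e, he⟩ : ∃ e, e ∉ Q := by
      by_contra! h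
      rw [Finset.eq_univ_of_forall h, Finset.card_univ] at hlt
      omega
    refine card_filter_eq_zero_of_involution _ (fun x => Function.update x e (!x e)) ?_ ?_ ?_
    · intro x; simp
    · intro x h
      simpa using congrFun h e
    · rintro x ⟨h1, h2⟩
      refine ⟨hp x _ (fun a ha => ?_) h1, h2⟩
      rw [Function.update_of_ne]
      rintro rfl
      exact he ha
  | node e t0 t1 ih0 ih1 =>
    intro Q p hp hlt
    simp only [DTree.depth] at hlt
    have hQ := Finset.card_insert_le e Q
    have hdep : ∀ b, ∀ x y : E → Bool, (∀ a ∈ insert e Q, x a = y a) →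
        (p x ∧ x e = b) → (p y ∧ y e = b) := by
      rintro b x y h ⟨h1, h2⟩
      exact ⟨hp x y (fun a ha => h a (Finset.mem_insert_of_mem ha)) h1,
        (h e (Finset.mem_insert_self e Q)) ▸ h2⟩
    have h0 := ih0 (insert e Q) (fun x => p x ∧ x e = false) (hdep false) (by omega)
    have h1 := ih1 (insert e Q) (fun x => p x ∧ x e = true) (hdep true) (by omega)
    rw [Finset.natCast_card_filter] at h0 h1 ⊢
    have h := congrArg₂ (· + ·) h0 h1
    rw [← Finset.sum_add_distrib, add_zero] at h
    refine Eq.trans (Finset.sum_congr rfl fun x _ => ?_) h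
    cases hx : x e <;> simp [DTree.eval, hx]

theorem DTree.card_le_depth (T : DTree E) (f : (E → Bool) → Prop)
    (hT : ∀ x, T.eval x = true ↔ f x) (hf : (#{x | f x} : ZMod 2) = 1) :
    Fintype.card E ≤ T.depth := by
  by_contra! hlt
  have h := T.card_filter_eq_zero ∅ (fun _ => True) (fun _ _ _ => id) (by simpa using hlt)
  simp only [hT, true_and] at h
  rw [h] at hf
  exact zero_ne_one hf

end DecisionTree

section Degree

variable {E R : Type} [Fintype E] [DecidableEq E] [CommRing R]

/-- Möbius inversion for the top coefficient of a multilinear representation. -/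
theorem coeff_univ_eq_sum (a : Finset E → R) :
    a Finset.univ = ∑ x : E → Bool, (∏ e, if x e then (1 : R) else -1) *
      ∑ S : Finset E, a S * ∏ e ∈ S, (if x e then (1 : R) else 0) := by
  simp_rw [Finset.mul_sum]
  rw [Finset.sum_comm]
  have h : ∀ S : Finset E, ∑ x : E → Bool, (∏ e, if x e then (1 : R) else -1) *
      (a S * ∏ e ∈ S, (if x e then (1 : R) else 0)) = if S = Finset.univ then a S else 0 := by
    intro S
    have h1 : ∀ x : E → Bool, (∏ e, if x e then (1 : R) else -1) *
        (a S * ∏ e ∈ S, (if x e then (1 : R) else 0)) = a S * ∏ e,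
          (if x e then 1 else if e ∈ S then 0 else -1) := by
      intro x
      rw [mul_left_comm, ← Finset.prod_ite_mem_eq S, ← Finset.prod_mul_distrib]
      congr 1
      refine Finset.prod_congr rfl fun e _ => ?_
      by_cases h1 : x e <;> by_cases h2 : e ∈ S <;> simp [h1, h2]
    rw [Finset.sum_congr rfl fun x _ => h1 x, ← Finset.mul_sum,
      ← Fintype.prod_sum fun (e : E) (b : Bool) => if b then (1 : R) else if e ∈ S then 0 else -1]
    split_ifs with hS
    · simp [hS]
    · obtain ⟨e, he⟩ : ∃ e, e ∉ S := by
        by_contra! h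
        exact hS (Finset.eq_univ_of_forall h)
      rw [Finset.prod_eq_zero (Finset.mem_univ e) (by simp [he]), mul_zero]
  simp [h]

/-- The top coefficient of a Boolean function is an integer congruent modulo 2 to its number of
true inputs. -/
theorem exists_int_coeff_univ (f : (E → Bool) → Prop) (hf : (#{x | f x} : ZMod 2) = 1) :
    ∃ z : ℤ, (z : ZMod 2) = 1 ∧ ∀ (R : Type) [CommRing R] (a : Finset E → R),
      (∀ x : E → Bool, (∑ S : Finset E, a S * ∏ e ∈ S, (if x e then (1 : R) else 0))
        = if f x then 1 else 0) → a Finset.univ = z := by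
  refine ⟨∑ x : E → Bool, (∏ e, if x e then 1 else -1) * if f x then 1 else 0, ?_, ?_⟩
  · have h2 : (-1 : ZMod 2) = 1 := by decide
    rw [← hf, Finset.natCast_card_filter]
    push_cast
    simp [h2]
  · intro R _ a ha
    rw [coeff_univ_eq_sum a, Finset.sum_congr rfl fun x _ => by rw [ha x]]
    push_cast
    rfl

end Degree

/-- the degree of `BPM_n` over the reals and over `𝔽₂` equals `n²` (the full
monomial has nonzero coefficient in both unique multilinear representations); consequently
`BPM_n` is evasive: its deterministic decision-tree query complexity is exactly `n²`. -/
theorem stmt11 (n : ℕ) :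
    -- full degree over the reals
    (∀ a : Finset (Edge n) → ℝ,
      (∀ x : Edge n → Bool,
        (∑ S : Finset (Edge n), a S * ∏ e ∈ S, (if x e then (1 : ℝ) else 0))
          = (if BPMb n x then 1 else 0)) →
      a Finset.univ ≠ 0) ∧
    -- full degree over 𝔽₂
    (∀ b : Finset (Edge n) → ZMod 2,
      (∀ x : Edge n → Bool,
        (∑ S : Finset (Edge n), b S * ∏ e ∈ S, (if x e then (1 : ZMod 2) else 0))
          = (if BPMb n x then 1 else 0)) →
      b Finset.univ ≠ 0) ∧
    -- evasiveness: query complexity is exactly n²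
    (∀ T : DTree (Edge n), (∀ x, T.eval x = true ↔ BPMb n x) → n ^ 2 ≤ T.depth) ∧
    (∃ T : DTree (Edge n), (∀ x, T.eval x = true ↔ BPMb n x) ∧ T.depth ≤ n ^ 2) := by
  obtain ⟨z, hz, hcoeff⟩ := exists_int_coeff_univ (BPMb n) (card_BPMb n)
  have hcard : Fintype.card (Edge n) = n ^ 2 := by simp [sq]
  refine ⟨fun a ha h => ?_, fun b hb h => ?_, fun T hT => ?_, ?_⟩
  · rw [hcoeff ℝ a ha, Int.cast_eq_zero] at h
    simp [h] at hz
  · rw [hcoeff (ZMod 2) b hb, hz] at h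
    exact one_ne_zero h
  · rw [← hcard]
    exact T.card_le_depth (BPMb n) hT (card_BPMb n)
  · obtain ⟨T, hT, hd⟩ := DTree.exists_eval_eq (Finset.univ : Finset (Edge n))
      (fun x => decide (BPMb n x)) fun x y hxy => by
        rw [funext fun e => hxy e (Finset.mem_univ e)]
    rw [Finset.card_univ, hcard] at hd
    exact ⟨T, fun x => by rw [hT x, decide_eq_true_iff], hd⟩
end

section
/- The number of bipartite graphs G ⊆ K_{n,n} (on labeled vertex sets of size n each) that contain a perfect matching is odd. Moreover, the number of matching-covered subgraphs of K_{n,n} is odd. -/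
open Finset
open scoped Classical

open Filter Topology in
/-- A point `t` and points slightly to its left are separated by a bounded interval, open or
reduced to a point, exactly when `t` is the right endpoint of that interval. -/
theorem eventually_mem_xor_iff_csSup_eq {I : Set ℝ} (hne : I.Nonempty) (hb : BddAbove I)
    (hI : (∃ c, I = {c}) ∨ (IsOpen I ∧ I.OrdConnected)) (t : ℝ) :
    ∀ᶠ s in 𝓝[<] t, (sSup I = t ↔ ¬ (t ∈ I ↔ s ∈ I)) := by
  rcases hI with ⟨c, rfl⟩ | ⟨ho, hc⟩
  · simp only [csSup_singleton, Set.mem_singleton_iff]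
    rcases eq_or_ne t c with rfl | h
    · filter_upwards [self_mem_nhdsWithin] with s (hs : s < t)
      simp [hs.ne]
    · filter_upwards [nhdsWithin_le_nhds (isOpen_ne.mem_nhds h)] with s (hs : s ≠ c)
      simp [hs, h, h.symm]
  · have hd : sSup I ∉ I := by
      intro hd
      obtain ⟨y, hy, hyI⟩ := mem_nhdsGT_iff_exists_Ioo_subset.1
        (nhdsWithin_le_nhds (ho.mem_nhds hd) : I ∈ 𝓝[>] (sSup I))
      obtain ⟨z, hz⟩ := exists_between (show sSup I < y from hy)
      exact absurd (le_csSup hb (hyI hz)) (not_le.2 hz.1)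
    by_cases htI : t ∈ I
    · have : sSup I ≠ t := fun h => hd (h ▸ htI)
      filter_upwards [nhdsWithin_le_nhds (ho.mem_nhds htI)] with s hs
      simp [hs, htI, this]
    rcases lt_trichotomy (sSup I) t with h | h | h
    · filter_upwards [nhdsWithin_le_nhds (Ioi_mem_nhds h)] with s (hs : sSup I < s)
      have : s ∉ I := fun h' => absurd (le_csSup hb h') (not_le.2 hs)
      simp [this, htI, h.ne]
    · obtain ⟨x, hx⟩ := hne
      have hxt : x < t := h ▸ lt_of_le_of_ne (le_csSup hb hx) (fun h' => hd (h' ▸ hx))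
      filter_upwards [Ioo_mem_nhdsLT hxt] with s hs
      obtain ⟨y, hy, hsy⟩ := exists_lt_of_lt_csSup ⟨x, hx⟩ (h ▸ hs.2)
      have : s ∈ I := hc.out hx hy ⟨hs.1.le, hsy.le⟩
      simp [this, htI, h]
    · obtain ⟨y, hy, hty⟩ := exists_lt_of_lt_csSup hne h
      filter_upwards [self_mem_nhdsWithin] with s (hs : s < t)
      have : s ∉ I := fun h' => htI (hc.out h' hy ⟨hs.le, hty.le⟩)
      simp [this, htI, h.ne']

/-- If every point of `[a, b]` lies in an odd number of members of a finite family of subintervals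
of `[a, b]`, each open or reduced to a point, then the family has an odd number of members. -/
theorem odd_card_of_odd_card_mem {α : Type*} (A : Finset α) (I : α → Set ℝ) {a b : ℝ} (hab : a ≤ b)
    (hne : ∀ k ∈ A, (I k).Nonempty) (hsub : ∀ k ∈ A, I k ⊆ Set.Icc a b)
    (hI : ∀ k ∈ A, (∃ c, I k = {c}) ∨ (IsOpen (I k) ∧ (I k).OrdConnected))
    (hodd : ∀ t ∈ Set.Icc a b, Odd (A.filter fun k => t ∈ I k).card) : Odd A.card := by
  have hbdd : ∀ k ∈ A, BddAbove (I k) := fun k hk => bddAbove_Icc.mono (hsub k hk)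
  have hsup : ∀ k ∈ A, sSup (I k) ∈ Set.Icc a b := fun k hk => by
    obtain ⟨x, hx⟩ := hne k hk
    exact ⟨(hsub k hk hx).1.trans (le_csSup (hbdd k hk) hx),
      csSup_le (hne k hk) fun y hy => (hsub k hk hy).2⟩
  have key : ∀ t ∈ Set.Icc a b,
      ((A.filter fun k => sSup (I k) = t).card : ZMod 2) = if t = a then 1 else 0 := by
    intro t ht
    have hev := (Filter.eventually_all_finset A).2 fun k hk =>
      eventually_mem_xor_iff_csSup_eq (hne k hk) (hbdd k hk) (hI k hk) t
    have hs : ∀ᶠ s in nhdsWithin t (Set.Iio t), s < t ∧ (t ≠ a → a ≤ s) := by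
      rcases eq_or_ne t a with rfl | h
      · filter_upwards [self_mem_nhdsWithin] with s hs using ⟨hs, by simp⟩
      · filter_upwards [Ioo_mem_nhdsLT (lt_of_le_of_ne ht.1 h.symm)] with s hs
        exact ⟨hs.2, fun _ => hs.1.le⟩
    obtain ⟨s, hs, hst, has⟩ := (hev.and hs).exists
    have h1 : ((A.filter fun k => sSup (I k) = t).card : ZMod 2)
        = (A.filter fun k => t ∈ I k).card + (A.filter fun k => s ∈ I k).card := by
      simp only [Finset.card_filter, Nat.cast_sum, ← Finset.sum_add_distrib]
      refine Finset.sum_congr rfl fun k hk => ?_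
      have := hs k hk
      by_cases h1 : t ∈ I k <;> by_cases h2 : s ∈ I k <;> simp [this, h1, h2]
      decide
    rw [h1, (ZMod.natCast_eq_one_iff_odd).2 (hodd t ht)]
    split_ifs with h
    · have : (A.filter fun k => s ∈ I k) = ∅ := by
        refine Finset.filter_eq_empty_iff.2 fun k hk h' => ?_
        have := (hsub k hk h').1
        linarith
      simp [this]
    · rw [(ZMod.natCast_eq_one_iff_odd).2 (hodd s ⟨has h, hst.le.trans ht.2⟩)]
      decide
  rw [← ZMod.natCast_eq_one_iff_odd,
    Finset.card_eq_sum_card_image (fun k => sSup (I k)) A, Nat.cast_sum]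
  have ha : a ∈ A.image fun k => sSup (I k) := by
    have h := key a ⟨le_rfl, hab⟩
    rw [if_pos rfl] at h
    have hn : (A.filter fun k => sSup (I k) = a).Nonempty := by
      rw [Finset.nonempty_iff_ne_empty]
      intro h0
      simp [h0] at h
    obtain ⟨k, hk⟩ := hn
    exact Finset.mem_image.2 ⟨k, (Finset.mem_filter.1 hk).1, (Finset.mem_filter.1 hk).2⟩
  rw [Finset.sum_congr rfl fun t ht => key t (by
    obtain ⟨k, hk, rfl⟩ := Finset.mem_image.1 ht
    exact hsup k hk)]
  rw [Finset.sum_ite_eq' _ a, if_pos ha]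

/-- `L` contains the line through any two of its points. -/
def IsFlat {ι : Type*} (L : Set (ι → ℝ)) : Prop :=
  ∀ x ∈ L, ∀ y ∈ L, ∀ r : ℝ, x + r • (y - x) ∈ L

/-- `x` is a nonnegative vector with support `K`. -/
def HasPosSupport {ι : Type*} (x : ι → ℝ) (K : Finset ι) : Prop :=
  0 ≤ x ∧ ∀ i, i ∈ K ↔ 0 < x i

theorem HasPosSupport.eq_zero {ι : Type*} {x : ι → ℝ} {K : Finset ι} (h : HasPosSupport x K)
    {i : ι} (hi : i ∉ K) : x i = 0 :=
  le_antisymm (not_lt.1 fun h' => hi ((h.2 i).2 h')) (h.1 i)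

theorem exists_hasPosSupport {ι : Type*} [Fintype ι] {x : ι → ℝ} (h : 0 ≤ x) :
    ∃ K, HasPosSupport x K :=
  ⟨Finset.univ.filter fun i => 0 < x i, h, by simp⟩

/-- The values of a coordinate on a relatively open face of `L ∩ ℝ≥0^ι` form a point or an open
interval. -/
theorem singleton_or_isOpen_image_face {ι : Type*} [Fintype ι] {L : Set (ι → ℝ)} (hL : IsFlat L)
    (K : Finset ι) (e : ι) (hne : ∃ x ∈ L, HasPosSupport x K) :
    (∃ c, {t | ∃ x ∈ L, HasPosSupport x K ∧ x e = t} = {c}) ∨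
      (IsOpen {t | ∃ x ∈ L, HasPosSupport x K ∧ x e = t} ∧
        Set.OrdConnected {t | ∃ x ∈ L, HasPosSupport x K ∧ x e = t}) := by
  have near : ∀ x ∈ L, HasPosSupport x K → ∀ y ∈ L, HasPosSupport y K → ∀ r : ℝ,
      (∀ i ∈ K, 0 < x i + r * (y i - x i)) →
        ∃ z ∈ L, HasPosSupport z K ∧ z e = x e + r * (y e - x e) := by
    intro x hxL hx y hyL hy r hr
    have h0 : ∀ i ∉ K, x i + r * (y i - x i) = 0 := fun i hi => by
      simp [hx.eq_zero hi, hy.eq_zero hi]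
    refine ⟨_, hL x hxL y hyL r, ⟨fun i => ?_, fun i => ?_⟩, by simp⟩
    · by_cases hi : i ∈ K
      · simpa using (hr i hi).le
      · simpa using (h0 i hi).ge
    · by_cases hi : i ∈ K
      · simpa [hi] using hr i hi
      · simpa [hi] using (h0 i hi).le
  obtain ⟨x₀, hx₀L, hx₀⟩ := hne
  by_cases hall : ∀ x ∈ L, HasPosSupport x K → x e = x₀ e
  · left
    refine ⟨x₀ e, Set.eq_singleton_iff_unique_mem.2 ⟨⟨x₀, hx₀L, hx₀, rfl⟩, ?_⟩⟩
    rintro _ ⟨x, hx, hxK, rfl⟩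
    exact hall x hx hxK
  right
  push Not at hall
  obtain ⟨y₀, hy₀L, hy₀, hxy⟩ := hall
  constructor
  · rw [isOpen_iff_mem_nhds]
    rintro _ ⟨x, hxL, hx, rfl⟩
    obtain ⟨y, hyL, hy, hyx⟩ : ∃ y ∈ L, HasPosSupport y K ∧ y e ≠ x e := by
      by_cases h : x₀ e = x e
      · exact ⟨y₀, hy₀L, hy₀, h ▸ hxy⟩
      · exact ⟨x₀, hx₀L, hx₀, h⟩
    have hev : ∀ᶠ s in nhds (x e), ∀ i ∈ K,
        0 < x i + (s - x e) / (y e - x e) * (y i - x i) := by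
      refine (Filter.eventually_all_finset K).2 fun i hi => ?_
      have hc : Continuous fun s : ℝ => x i + (s - x e) / (y e - x e) * (y i - x i) := by
        fun_prop
      refine (isOpen_Ioi.preimage hc).mem_nhds ?_
      simpa using (hx.2 i).1 hi
    filter_upwards [hev] with s hs
    obtain ⟨z, hzL, hz, hze⟩ := near x hxL hx y hyL hy _ hs
    refine ⟨z, hzL, hz, hze.trans ?_⟩
    field_simp [sub_ne_zero.2 hyx]
    ring
  · refine ⟨?_⟩
    rintro _ ⟨x, hxL, hx, rfl⟩ _ ⟨y, hyL, hy, rfl⟩ t ht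
    rcases (ht.1.trans ht.2).eq_or_lt with h | h
    · exact ⟨x, hxL, hx, le_antisymm ht.1 (h ▸ ht.2)⟩
    have h' := sub_pos.2 h
    have hr0 : 0 ≤ (t - x e) / (y e - x e) := div_nonneg (sub_nonneg.2 ht.1) h'.le
    have hr1 : (t - x e) / (y e - x e) ≤ 1 := (div_le_one h').2 (by linarith [ht.2])
    obtain ⟨z, hzL, hz, hze⟩ := near x hxL hx y hyL hy ((t - x e) / (y e - x e)) fun i hi => by
      have h1 := (hx.2 i).1 hi
      have h2 := (hy.2 i).1 hi
      rcases hr1.eq_or_lt with h3 | h3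
      · rw [h3]; linarith
      · nlinarith [mul_nonneg hr0 h2.le, mul_pos (sub_pos.2 h3) h1]
    refine ⟨z, hzL, hz, hze.trans ?_⟩
    field_simp
    ring

/-- Euler's relation modulo 2: a polytope `L ∩ ℝ≥0^ι`, with `L` an affine subspace, has an odd
number of nonempty faces. -/
theorem odd_card_supports {ι : Type*} [Fintype ι] {L : Set (ι → ℝ)} (hL : IsFlat L)
    (hcpt : IsCompact {x ∈ L | 0 ≤ x}) (hne : {x ∈ L | 0 ≤ x}.Nonempty) :
    Odd (Finset.univ.filter fun K : Finset ι => ∃ x ∈ L, HasPosSupport x K).card := by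
  suffices H : ∀ (s : Finset ι) (L : Set (ι → ℝ)), IsFlat L → IsCompact {x ∈ L | 0 ≤ x} →
      {x ∈ L | 0 ≤ x}.Nonempty → (∀ x ∈ L, ∀ y ∈ L, ∀ i ∉ s, x i = y i) →
      Odd (Finset.univ.filter fun K : Finset ι => ∃ x ∈ L, HasPosSupport x K).card from
    H Finset.univ L hL hcpt hne (by simp)
  clear! L
  intro s
  induction s using Finset.induction_on with
  | empty =>
    rintro L - - ⟨x, hxL, hx⟩ hc
    obtain ⟨K, hK⟩ := exists_hasPosSupport hx
    have : (Finset.univ.filter fun K : Finset ι => ∃ x ∈ L, HasPosSupport x K) = {K} := by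
      ext K'
      simp only [Finset.mem_filter, Finset.mem_univ, true_and, Finset.mem_singleton]
      constructor
      · rintro ⟨y, hyL, hy⟩
        obtain rfl : x = y := funext fun i => hc x hxL y hyL i (by simp)
        ext i
        rw [hy.2, hK.2]
      · rintro rfl
        exact ⟨x, hxL, hK⟩
    simp [this]
  | insert e s _ ih =>
    intro L hL hcpt hne hc
    have hcont : ContinuousOn (fun x : ι → ℝ => x e) {x ∈ L | 0 ≤ x} :=
      (continuous_apply e).continuousOn
    obtain ⟨u, ⟨huL, hu⟩, humin⟩ := hcpt.exists_isMinOn hne hcont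
    obtain ⟨v, ⟨hvL, hv⟩, hvmax⟩ := hcpt.exists_isMaxOn hne hcont
    have huv : u e ≤ v e := humin ⟨hvL, hv⟩
    refine odd_card_of_odd_card_mem _
      (fun K => {t | ∃ x ∈ L, HasPosSupport x K ∧ x e = t}) huv ?_ ?_ ?_ ?_
    · intro K hK
      obtain ⟨x, hxL, hx⟩ := (Finset.mem_filter.1 hK).2
      exact ⟨_, x, hxL, hx, rfl⟩
    · rintro K - _ ⟨x, hxL, hx, rfl⟩
      exact ⟨humin ⟨hxL, hx.1⟩, hvmax ⟨hxL, hx.1⟩⟩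
    · intro K hK
      exact singleton_or_isOpen_image_face hL K e (Finset.mem_filter.1 hK).2
    · intro t ht
      have hflat : IsFlat {x ∈ L | x e = t} := by
        rintro x ⟨hxL, hx⟩ y ⟨hyL, hy⟩ r
        exact ⟨hL x hxL y hyL r, by simp [hx, hy]⟩
      have hcpt' : IsCompact {x ∈ {x ∈ L | x e = t} | 0 ≤ x} := by
        convert hcpt.inter_right (isClosed_eq (continuous_apply e)
          (continuous_const (y := t))) using 1
        ext x
        simp only [Set.mem_ofPred_eq, Set.mem_inter_iff]
        tauto
      have hne' : {x ∈ {x ∈ L | x e = t} | 0 ≤ x}.Nonempty := by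
        rcases huv.eq_or_lt with h | h
        · exact ⟨u, ⟨huL, le_antisymm (ht.1) (h ▸ ht.2)⟩, hu⟩
        have h' := sub_pos.2 h
        have hr0 : 0 ≤ (t - u e) / (v e - u e) := div_nonneg (sub_nonneg.2 ht.1) h'.le
        have hr1 : (t - u e) / (v e - u e) ≤ 1 := (div_le_one h').2 (by linarith [ht.2])
        refine ⟨_, ⟨hL u huL v hvL ((t - u e) / (v e - u e)), ?_⟩, fun i => ?_⟩
        · simp only [Pi.add_apply, Pi.smul_apply, Pi.sub_apply, smul_eq_mul]
          field_simp
          ring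
        · have h1 := hu i
          have h2 := hv i
          simp only [Pi.zero_apply, Pi.add_apply, Pi.smul_apply, Pi.sub_apply,
            smul_eq_mul] at h1 h2 ⊢
          nlinarith [mul_nonneg hr0 h2, mul_nonneg (sub_nonneg.2 hr1) h1]
      have := ih {x ∈ L | x e = t} hflat hcpt' hne' (by
        rintro x ⟨hxL, hx⟩ y ⟨hyL, hy⟩ i hi
        by_cases hie : i = e
        · rw [hie, hx, hy]
        · exact hc x hxL y hyL i (by simp [hie, hi]))
      convert this using 2
      ext K
      simp only [Finset.mem_filter, Finset.mem_univ, true_and, Set.mem_ofPred_eq]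
      constructor
      · rintro ⟨-, x, hxL, hx, hxe⟩
        exact ⟨x, ⟨hxL, hxe⟩, hx⟩
      · rintro ⟨x, ⟨hxL, hxe⟩, hx⟩
        exact ⟨⟨x, hxL, hx⟩, x, hxL, hx, hxe⟩

/-- The real matrices with unit row and column sums that vanish outside `H`. -/
def unitSums {n : ℕ} (H : Finset (Edge n)) : Set (Edge n → ℝ) :=
  {x | (∀ i, ∑ j, x (i, j) = 1) ∧ (∀ j, ∑ i, x (i, j) = 1) ∧ ∀ e ∉ H, x e = 0}

theorem isFlat_unitSums {n : ℕ} (H : Finset (Edge n)) : IsFlat (unitSums H) := by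
  rintro x ⟨hx1, hx2, hx3⟩ y ⟨hy1, hy2, hy3⟩ r
  refine ⟨fun i => ?_, fun j => ?_, fun e he => ?_⟩
  · simp [Finset.sum_add_distrib, ← Finset.mul_sum, hx1, hy1]
  · simp [Finset.sum_add_distrib, ← Finset.mul_sum, hx2, hy2]
  · simp [hx3 e he, hy3 e he]

theorem isCompact_nonneg_unitSums {n : ℕ} (H : Finset (Edge n)) :
    IsCompact {x ∈ unitSums H | 0 ≤ x} := by
  refine (isCompact_Icc (a := (0 : Edge n → ℝ)) (b := 1)).of_isClosed_subset ?_ ?_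
  · have : {x ∈ unitSums H | 0 ≤ x} =
        (⋂ i, {x | ∑ j, x (i, j) = 1}) ∩ (⋂ j, {x | ∑ i, x (i, j) = 1}) ∩
          (⋂ e ∈ (H : Set (Edge n))ᶜ, {x | x e = 0}) ∩ Set.Ici 0 := by
      ext x
      simp [unitSums, and_assoc]
    rw [this]
    refine ((IsClosed.inter ?_ ?_).inter ?_).inter isClosed_Ici
    · exact isClosed_iInter fun i => isClosed_eq (by fun_prop) continuous_const
    · exact isClosed_iInter fun j => isClosed_eq (by fun_prop) continuous_const
    · exact isClosed_biInter fun e _ => isClosed_eq (by fun_prop) continuous_const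
  · rintro x ⟨⟨hx, -, -⟩, h0⟩
    refine ⟨h0, fun e => ?_⟩
    rw [Pi.one_apply, ← hx e.1]
    exact Finset.single_le_sum (f := fun j => x (e.1, j)) (fun j _ => h0 _) (Finset.mem_univ e.2)

/-- The indicator of the perfect matching of `σ`. -/
noncomputable def matchingVec {n : ℕ} (σ : Equiv.Perm (Fin n)) (e : Edge n) : ℝ :=
  if σ e.1 = e.2 then 1 else 0

theorem matchingVec_nonneg {n : ℕ} (σ : Equiv.Perm (Fin n)) (e : Edge n) :
    0 ≤ matchingVec σ e := by
  unfold matchingVec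
  split_ifs <;> norm_num

theorem sum_matchingVec_row {n : ℕ} (σ : Equiv.Perm (Fin n)) (i : Fin n) :
    ∑ j, matchingVec σ (i, j) = 1 := by
  simp [matchingVec]

theorem sum_matchingVec_col {n : ℕ} (σ : Equiv.Perm (Fin n)) (j : Fin n) :
    ∑ i, matchingVec σ (i, j) = 1 := by
  simp [matchingVec, ← Equiv.eq_symm_apply]

/-- A graph is matching-covered when some nonempty set of permutations has it as the union of
their graphs. -/
theorem matchingCovered_iff {n : ℕ} (G : Finset (Edge n)) :
    matchingCovered G ↔ ∃ S : Finset (Equiv.Perm (Fin n)), S.Nonempty ∧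
      ∀ e, e ∈ G ↔ ∃ σ ∈ S, σ e.1 = e.2 := by
  have hmem : ∀ (σ : Equiv.Perm (Fin n)) (e : Edge n),
      (e ∈ Finset.univ.image fun i => (i, σ i)) ↔ σ e.1 = e.2 := by
    rintro σ ⟨i, j⟩
    simp
  constructor
  · rintro ⟨S, ⟨M₀, hM₀⟩, hPM, rfl⟩
    refine ⟨Finset.univ.filter fun σ => (Finset.univ.image fun i => (i, σ i)) ∈ S, ?_, fun e => ?_⟩
    · obtain ⟨σ, rfl⟩ := hPM _ hM₀
      exact ⟨σ, by simpa using hM₀⟩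
    · simp only [Finset.mem_sup, id, Finset.mem_filter, Finset.mem_univ, true_and]
      constructor
      · rintro ⟨M, hM, he⟩
        obtain ⟨σ, rfl⟩ := hPM _ hM
        exact ⟨σ, hM, (hmem σ e).1 he⟩
      · rintro ⟨σ, hσ, he⟩
        exact ⟨_, hσ, (hmem σ e).2 he⟩
  · rintro ⟨S, hS, h⟩
    refine ⟨S.image fun σ => Finset.univ.image fun i => (i, σ i), hS.image _, ?_, ?_⟩
    · intro M hM
      obtain ⟨σ, -, rfl⟩ := Finset.mem_image.1 hM
      exact ⟨σ, rfl⟩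
    · ext e
      rw [h e]
      simp only [Finset.mem_sup, id, Finset.mem_image (s := S), exists_exists_and_eq_and, hmem]

/-- Matching-covered graphs are the supports of doubly stochastic matrices. -/
theorem exists_unitSums_hasPosSupport_iff {n : ℕ} (H K : Finset (Edge n)) :
    (∃ x ∈ unitSums H, HasPosSupport x K) ↔ matchingCovered K ∧ K ⊆ H := by
  rw [matchingCovered_iff]
  constructor
  · rintro ⟨x, ⟨hr, hc, hH⟩, hx⟩
    refine ⟨?_, fun e he => by_contra fun h => ((hx.2 e).1 he).ne' (hH e h)⟩
    have hds : (Matrix.of fun i j => x (i, j)) ∈ doublyStochastic ℝ (Fin n) := by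
      rw [mem_doublyStochastic_iff_sum]
      exact ⟨fun i j => hx.1 (i, j), hr, hc⟩
    obtain ⟨w, hw0, hw1, hw⟩ := exists_eq_sum_perm_of_mem_doublyStochastic hds
    refine ⟨Finset.univ.filter fun σ => 0 < w σ, ?_, ?_⟩
    · obtain ⟨σ, -, hσ⟩ := Finset.exists_lt_of_sum_lt (s := Finset.univ) (f := 0) (g := w)
        (by simp [hw1])
      exact ⟨σ, by simpa using hσ⟩
    · rintro ⟨i, j⟩
      have hxe : x (i, j) = ∑ σ, w σ * matchingVec σ (i, j) := by
        have := congrFun (congrFun hw i) j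
        simp only [Matrix.sum_apply, Matrix.smul_apply, Matrix.of_apply, smul_eq_mul] at this
        rw [← this]
        refine Finset.sum_congr rfl fun σ _ => ?_
        simp [matchingVec, Equiv.Perm.permMatrix, PEquiv.toMatrix_apply]
      have hnn : ∀ σ ∈ Finset.univ, 0 ≤ w σ * matchingVec σ (i, j) := fun σ _ =>
        mul_nonneg (hw0 σ) (matchingVec_nonneg _ _)
      rw [hx.2, hxe, Finset.sum_pos_iff_of_nonneg hnn]
      refine exists_congr fun σ => ?_
      by_cases h : σ i = j <;> simp [matchingVec, h]
  · rintro ⟨⟨S, hS, h⟩, hKH⟩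
    have hcard : (0 : ℝ) < S.card := by exact_mod_cast hS.card_pos
    have hnn : ∀ e, ∀ σ ∈ S, 0 ≤ matchingVec σ e := fun e σ _ => matchingVec_nonneg _ _
    have hpos : HasPosSupport (fun e => (S.card : ℝ)⁻¹ * ∑ σ ∈ S, matchingVec σ e) K := by
      refine ⟨fun e => mul_nonneg (inv_nonneg.2 hcard.le) (Finset.sum_nonneg (hnn e)),
        fun e => ?_⟩
      rw [mul_pos_iff_of_pos_left (inv_pos.2 hcard), Finset.sum_pos_iff_of_nonneg (hnn e), h]
      refine exists_congr fun σ => and_congr_right fun _ => ?_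
      by_cases h : σ e.1 = e.2 <;> simp [matchingVec, h]
    refine ⟨_, ⟨fun i => ?_, fun j => ?_, fun e he => ?_⟩, hpos⟩
    · rw [← Finset.mul_sum, Finset.sum_comm]
      simp [sum_matchingVec_row, hcard.ne']
    · rw [← Finset.mul_sum, Finset.sum_comm]
      simp [sum_matchingVec_col, hcard.ne']
    · exact hpos.eq_zero fun h' => he (hKH h')

/-- A graph with a perfect matching has an odd number of matching-covered subgraphs. -/
theorem odd_card_matchingCovered_subset {n : ℕ} {H : Finset (Edge n)} (hH : hasPM H) :
    Odd (Finset.univ.filter fun K => matchingCovered K ∧ K ⊆ H).card := by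
  have hne : {x ∈ unitSums H | 0 ≤ x}.Nonempty := by
    obtain ⟨σ, hσ⟩ := hH
    refine ⟨matchingVec σ, ⟨sum_matchingVec_row σ, sum_matchingVec_col σ, ?_⟩,
      matchingVec_nonneg σ⟩
    rintro ⟨i, j⟩ he
    exact if_neg fun h : σ i = j => he (h ▸ hσ i)
  simpa only [exists_unitSums_hasPosSupport_iff] using
    odd_card_supports (isFlat_unitSums H) (isCompact_nonneg_unitSums H) hne

theorem hasPM.mono {n : ℕ} {G H : Finset (Edge n)} (hG : hasPM G) (h : G ⊆ H) : hasPM H :=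
  hG.imp fun _ hσ i => h (hσ i)

theorem matchingCovered.hasPM {n : ℕ} {G : Finset (Edge n)} (h : matchingCovered G) : hasPM G := by
  obtain ⟨S, ⟨σ, hσ⟩, hS⟩ := (matchingCovered_iff G).1 h
  exact ⟨σ, fun i => (hS _).2 ⟨σ, hσ, rfl⟩⟩

theorem matchingCovered_univ (n : ℕ) : matchingCovered (Finset.univ : Finset (Edge n)) :=
  (matchingCovered_iff _).2 ⟨Finset.univ, Finset.univ_nonempty, fun e => by
    simpa using ⟨Equiv.swap e.1 e.2, Equiv.swap_apply_left _ _⟩⟩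

/-- The number of finite sets containing `K` is odd exactly when `K` is everything. -/
theorem natCast_card_filter_superset {α : Type*} [Fintype α] [DecidableEq α] (K : Finset α) :
    ((Finset.univ.filter fun G : Finset α => K ⊆ G).card : ZMod 2) =
      if K = Finset.univ then 1 else 0 := by
  have h : (Finset.univ.filter fun G : Finset α => K ⊆ G) = Finset.Icc K Finset.univ := by
    ext G
    simp
  rw [h, Finset.card_Icc_finset (Finset.subset_univ K)]
  split_ifs with hK
  · simp [hK]
  · have : Finset.card Finset.univ - K.card ≠ 0 :=
      (Nat.sub_pos_of_lt (Finset.card_lt_card (Finset.ssubset_univ_iff.2 hK))).ne'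
    rw [Nat.cast_pow, show ((2 : ℕ) : ZMod 2) = 0 from rfl, zero_pow this]

/-- the number of subgraphs of `K_{n,n}` containing a perfect matching is odd,
and the number of matching-covered subgraphs of `K_{n,n}` is odd. -/
theorem stmt12 (n : ℕ) :
    Odd (Finset.univ.filter fun G : Finset (Edge n) => hasPM G).card ∧
    Odd (Finset.univ.filter fun G : Finset (Edge n) => matchingCovered G).card := by
  constructor
  · have hcount : ∀ G : Finset (Edge n), (if hasPM G then 1 else 0 : ZMod 2) =
        ∑ K with matchingCovered K, if K ⊆ G then 1 else 0 := by
      intro G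
      rw [← Finset.sum_filter, Finset.filter_filter, Finset.sum_const, nsmul_one]
      split_ifs with hG
      · exact ((ZMod.natCast_eq_one_iff_odd).2 (odd_card_matchingCovered_subset hG)).symm
      · rw [Finset.filter_false_of_mem fun K _ h => hG (h.1.hasPM.mono h.2)]
        simp
    rw [← ZMod.natCast_eq_one_iff_odd, Finset.card_filter, Nat.cast_sum]
    push_cast
    rw [Finset.sum_congr rfl fun G _ => hcount G, Finset.sum_comm]
    simp_rw [← Finset.sum_filter, Finset.sum_const, nsmul_one, natCast_card_filter_superset]
    simp [matchingCovered_univ]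
  · simpa using odd_card_matchingCovered_subset (matchingCovered_univ n).hasPM
end
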